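/- arXiv:2304.10685 — 7 statements merged into one kernel-verified Lean document; each statement's English description precedes it below -/
import Mathlib

section
/- Let H be a complex Hilbert space and let U be a unitary bounded linear operator on H. Suppose there exist ν₀ ∈ ℝ and δ ∈ [0, π] such that the spectrum of U is contained in the closed arc {e^{−iν} : ν ∈ ℝ, |ν − ν₀| ≤ δ} of the unit circle. Then for every u ∈ H, ‖U u − e^{−iν₀} u‖ ≤ 2·sin(δ/2)·‖u‖. -/
open scoped ComplexConjugate

/-- **Centering lemma for unitary operators.** If the spectrum of a unitary operator `U`
on a complex Hilbert space is contained in the closed arc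
`{e^{-iν} : |ν - ν₀| ≤ δ}` of the unit circle (with `0 ≤ δ ≤ π`), then
`‖U u - e^{-iν₀} u‖ ≤ 2 sin(δ/2) ‖u‖` for all `u`. -/
theorem centering_lemma
    {H : Type*} [NormedAddCommGroup H] [InnerProductSpace ℂ H] [CompleteSpace H]
    (U : H →L[ℂ] H) (hU : U ∈ unitary (H →L[ℂ] H))
    (ν₀ δ : ℝ) (hδ0 : 0 ≤ δ) (hδπ : δ ≤ Real.pi)
    (hspec : spectrum ℂ U ⊆
      {z : ℂ | ∃ ν : ℝ, |ν - ν₀| ≤ δ ∧ z = Complex.exp (-(ν : ℂ) * Complex.I)}) :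
    ∀ u : H, ‖U u - Complex.exp (-(ν₀ : ℂ) * Complex.I) • u‖ ≤ 2 * Real.sin (δ / 2) * ‖u‖ := by
  set c : ℂ := Complex.exp (-(ν₀ : ℂ) * Complex.I) with hc
  have hs0 : 0 ≤ 2 * Real.sin (δ / 2) := by
    have := Real.sin_nonneg_of_nonneg_of_le_pi (x := δ / 2) (by linarith) (by linarith)
    linarith
  -- pointwise estimate on the arc
  have key : ∀ ν : ℝ, |ν - ν₀| ≤ δ →
      ‖Complex.exp (-(ν : ℂ) * Complex.I) - c‖ ≤ 2 * Real.sin (δ / 2) := by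
    intro ν hν
    have h1 : Complex.exp (-(ν : ℂ) * Complex.I) - c
        = Complex.exp (((-ν₀ : ℝ) : ℂ) * Complex.I) *
          (Complex.exp (Complex.I * ((ν₀ - ν : ℝ) : ℂ)) - 1) := by
      rw [mul_sub, ← Complex.exp_add, hc]
      push_cast
      ring_nf
    rw [h1, norm_mul, Complex.norm_exp_ofReal_mul_I, one_mul,
      Complex.norm_exp_I_mul_ofReal_sub_one, Real.norm_eq_abs, abs_mul, abs_two]
    have h2 : |(ν₀ - ν) / 2| ≤ δ / 2 := by
      rw [abs_div, abs_two, abs_sub_comm]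
      linarith
    rw [Real.abs_sin_eq_sin_abs_of_abs_le_pi (by linarith)]
    have := Real.sin_le_sin_of_le_of_le_pi_div_two
      (by linarith [abs_nonneg ((ν₀ - ν) / 2)]) (by linarith) h2
    linarith
  set T : H →L[ℂ] H := U - algebraMap ℂ (H →L[ℂ] H) c with hT
  have hUn : Commute (star U) U := by
    rw [Unitary.mem_iff] at hU
    exact hU.1.trans hU.2.symm
  have hn : IsStarNormal T := by
    constructor
    rw [hT, star_sub, ← algebraMap_star_comm]
    exact ((hUn.sub_right (Algebra.commutes c (star U)).symm)).sub_left
      (Algebra.commutes (star c) _)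
  have hnorm : ‖T‖ ≤ 2 * Real.sin (δ / 2) := by
    have h := IsStarNormal.spectralRadius_eq_nnnorm T
    have hle : spectralRadius ℂ T ≤ ((2 * Real.sin (δ / 2)).toNNReal : ENNReal) := by
      refine iSup₂_le fun z hz => ?_
      rw [hT, ← spectrum.sub_singleton_eq] at hz
      obtain ⟨w, hw, c', rfl, rfl⟩ := hz
      obtain ⟨ν, hν, rfl⟩ := hspec hw
      rw [ENNReal.coe_le_coe, ← NNReal.coe_le_coe, Real.coe_toNNReal _ hs0]
      exact key ν hν
    rw [h, ENNReal.coe_le_coe, ← NNReal.coe_le_coe, Real.coe_toNNReal _ hs0] at hle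
    exact hle
  intro u
  have hTu : U u - c • u = T u := by
    simp [hT, Algebra.algebraMap_eq_smul_one]
  rw [hTu]
  exact T.le_of_opNorm_le hnorm u
end

section
/- Let H be a complex Hilbert space and let U be a unitary bounded linear operator on H. Let g₀ ∈ [0, π) and suppose the spectrum of U is contained in the closed arc {e^{−iν} : ν ∈ ℝ, |ν| ≤ g₀}. Then for every ν₀ ∈ ℝ with g₀ < ν₀ ≤ π and every v ∈ H, ‖U v − e^{−iν₀} v‖ ≥ 2·sin((ν₀ − g₀)/2)·‖v‖. -/
theorem arc_dist_aux (g ν₀ ν : ℝ) (h1 : g < ν₀) (h2 : ν₀ ≤ Real.pi) (hν : |ν| ≤ g) :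
    2 * Real.sin ((ν₀ - g) / 2) ≤
      ‖Complex.exp (-(ν : ℂ) * Complex.I) - Complex.exp (-(ν₀ : ℂ) * Complex.I)‖ := by
  obtain ⟨ha, hb⟩ := abs_le.mp hν
  have e : Complex.exp (-(ν : ℂ) * Complex.I) - Complex.exp (-(ν₀ : ℂ) * Complex.I)
      = Complex.exp ((-ν₀ : ℝ) * Complex.I) *
        (Complex.exp (Complex.I * ((ν₀ - ν : ℝ) : ℂ)) - 1) := by
    rw [mul_sub, ← Complex.exp_add, mul_one]
    push_cast
    ring_nf
  rw [e, norm_mul, Complex.norm_exp_ofReal_mul_I, one_mul,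
    Complex.norm_exp_I_mul_ofReal_sub_one]
  refine le_trans ?_ (le_abs_self _)
  have hs : Real.sin ((ν₀ - g) / 2) ≤ Real.sin ((ν₀ - ν) / 2) := by
    rcases le_total ((ν₀ - ν) / 2) (Real.pi / 2) with h | h
    · exact Real.sin_le_sin_of_le_of_le_pi_div_two (by linarith [Real.pi_pos]) h (by linarith)
    · rw [← Real.sin_pi_sub ((ν₀ - ν) / 2)]
      exact Real.sin_le_sin_of_le_of_le_pi_div_two (by linarith [Real.pi_pos])
        (by linarith) (by linarith)
  linarith

/-- **Lower bound away from the quasi-energy arc.** If the spectrum of a unitary operator `U`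
on a complex Hilbert space is contained in the closed arc `{e^{-iν} : |ν| ≤ g₀}` with
`0 ≤ g₀ < π`, then for every `ν₀` with `g₀ < ν₀ ≤ π` and every `v`,
`‖U v - e^{-iν₀} v‖ ≥ 2 sin((ν₀ - g₀)/2) ‖v‖`. -/
theorem unitary_spectral_lower_bound
    {H : Type*} [NormedAddCommGroup H] [InnerProductSpace ℂ H] [CompleteSpace H]
    (U : H →L[ℂ] H) (hU : U ∈ unitary (H →L[ℂ] H))
    (g₀ : ℝ) (hg₀0 : 0 ≤ g₀) (hg₀π : g₀ < Real.pi)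
    (hspec : spectrum ℂ U ⊆
      {z : ℂ | ∃ ν : ℝ, |ν| ≤ g₀ ∧ z = Complex.exp (-(ν : ℂ) * Complex.I)}) :
    ∀ (ν₀ : ℝ), g₀ < ν₀ → ν₀ ≤ Real.pi → ∀ v : H,
      2 * Real.sin ((ν₀ - g₀) / 2) * ‖v‖ ≤
        ‖U v - Complex.exp (-(ν₀ : ℂ) * Complex.I) • v‖ := by
  intro ν₀ h1 h2 v
  set w : ℂ := Complex.exp (-(ν₀ : ℂ) * Complex.I) with hw
  set c : ℝ := 2 * Real.sin ((ν₀ - g₀) / 2) with hc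
  have hcpos : 0 < c :=
    mul_pos two_pos (Real.sin_pos_of_pos_of_lt_pi (by linarith) (by linarith [Real.pi_pos]))
  have hd : ∀ z ∈ spectrum ℂ U, c ≤ ‖z - w‖ := by
    intro z hz
    obtain ⟨ν, hν, rfl⟩ := hspec hz
    exact arc_dist_aux g₀ ν₀ ν h1 h2 hν
  have hne : ∀ z ∈ spectrum ℂ U, z - w ≠ 0 := fun z hz =>
    norm_pos_iff.mp (hcpos.trans_le (hd z hz))
  have hn : IsStarNormal U :=
    ⟨((Unitary.mem_iff.mp hU).1).trans ((Unitary.mem_iff.mp hU).2).symm⟩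
  have hcont : ContinuousOn (fun z : ℂ => (z - w)⁻¹) (spectrum ℂ U) :=
    ContinuousOn.inv₀ (by fun_prop) hne
  have hR : ‖cfc (fun z : ℂ => (z - w)⁻¹) U‖ ≤ c⁻¹ := by
    refine norm_cfc_le (inv_nonneg.mpr hcpos.le) fun z hz => ?_
    rw [norm_inv]
    exact inv_anti₀ hcpos (hd z hz)
  have hsub : cfc (fun z : ℂ => z - w) U = U - algebraMap ℂ (H →L[ℂ] H) w := by
    rw [cfc_sub (fun z : ℂ => z) (fun _ => w) U, cfc_id' ℂ U, cfc_const w U]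
  have hmul : cfc (fun z : ℂ => (z - w)⁻¹) U * (U - algebraMap ℂ (H →L[ℂ] H) w) = 1 := by
    rw [← hsub, ← cfc_mul _ _ U hcont (by fun_prop), ← cfc_one ℂ U]
    exact cfc_congr fun z hz => inv_mul_cancel₀ (hne z hz)
  have hv : cfc (fun z : ℂ => (z - w)⁻¹) U (U v - w • v) = v := by
    have := congrArg (fun T : H →L[ℂ] H => T v) hmul
    simpa [Algebra.algebraMap_eq_smul_one] using this
  have hle : ‖v‖ ≤ c⁻¹ * ‖U v - w • v‖ := by
    calc ‖v‖ = ‖cfc (fun z : ℂ => (z - w)⁻¹) U (U v - w • v)‖ := by rw [hv]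
      _ ≤ _ := ContinuousLinearMap.le_of_opNorm_le _ hR _
  calc c * ‖v‖ ≤ c * (c⁻¹ * ‖U v - w • v‖) := by gcongr
    _ = ‖U v - w • v‖ := by field_simp
end

section
/- Let n ≥ 1. Let p : ℝⁿ → ℂ be measurable and ℤⁿ-periodic, with p integrable on the unit cell [0,1)ⁿ. Let q : ℝⁿ → ℂ be a Schwartz function whose Fourier transform 𝓕q vanishes outside the closed ball of radius d > 0 centered at the origin. Then for every ε with 0 < ε and ε·d < 1, the function x ↦ p(x)·q(ε x) is integrable on ℝⁿ and ∫_{ℝⁿ} p(x)·q(ε x) dx = ε^{−n} · (∫_{[0,1)ⁿ} p(x) dx) · (∫_{ℝⁿ} q(X) dX). -/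
open MeasureTheory FourierTransform
open scoped SchwartzMap

namespace AvgLemma

noncomputable abbrev stdB (n : ℕ) : Module.Basis (Fin n) ℝ (EuclideanSpace ℝ (Fin n)) :=
  (EuclideanSpace.basisFun (Fin n) ℝ).toBasis

abbrev Lat (n : ℕ) : Submodule ℤ (EuclideanSpace ℝ (Fin n)) :=
  Submodule.span ℤ (Set.range (stdB n))

abbrev cell (n : ℕ) : Set (EuclideanSpace ℝ (Fin n)) := {x | ∀ i, x i ∈ Set.Ico (0 : ℝ) 1}

lemma fd_eq (n : ℕ) : ZSpan.fundamentalDomain (stdB n) = cell n := by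
  ext x
  simp [ZSpan.mem_fundamentalDomain, cell, stdB]

lemma isFD (n : ℕ) : IsAddFundamentalDomain (Lat n) (cell n) volume := by
  rw [← fd_eq]
  exact ZSpan.isAddFundamentalDomain (stdB n) volume

lemma lat_coord {n : ℕ} (l : Lat n) : ∃ m : Fin n → ℤ,
    (l : EuclideanSpace ℝ (Fin n)) = (WithLp.equiv 2 (Fin n → ℝ)).symm (fun i => (m i : ℝ)) := by
  have h := (Module.Basis.mem_span_iff_repr_mem ℤ (stdB n) l.1).1 l.2
  choose m hm using h
  refine ⟨m, ?_⟩
  ext i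
  simpa [stdB] using (hm i).symm

lemma coord_lat {n : ℕ} (m : Fin n → ℤ) :
    (WithLp.equiv 2 (Fin n → ℝ)).symm (fun i => (m i : ℝ)) ∈ Lat n := by
  refine (Module.Basis.mem_span_iff_repr_mem ℤ (stdB n) _).2 fun i => ⟨m i, ?_⟩
  simp [stdB]

lemma bound {n : ℕ} (g : EuclideanSpace ℝ (Fin n) → ℂ) (C : ℝ)
    (hg : ∀ x, ‖g x‖ * (1 + ‖x‖) ^ (n + 1) ≤ C) (R : ℝ) (hR : 0 ≤ R) :
    ∃ B : Lat n → ℝ, (∀ l, 0 ≤ B l) ∧ Summable B ∧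
      ∀ (l : Lat n) (x : EuclideanSpace ℝ (Fin n)), ‖x‖ ≤ R → ‖g (l + x)‖ ≤ B l := by
  classical
  have hC : 0 ≤ C := le_trans (by positivity) (hg 0)
  have hfr : Module.finrank ℤ (Lat n) = n := by
    rw [ZLattice.rank ℝ (Lat n)]; simp
  refine ⟨fun l => C * (1 + R) ^ (n + 1) * ‖l‖⁻¹ ^ (n + 1) + (if l = 0 then C else 0),
    fun l => by positivity, ?_, ?_⟩
  · refine ((ZLattice.summable_norm_pow_inv (Lat n) (n + 1) (by omega)).mul_left _).add ?_
    exact summable_of_ne_finset_zero (s := {0}) (by intro b hb; simp at hb; simp [hb])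
  · intro l x hx
    by_cases hl : l = 0
    · subst hl
      have h1 := hg ((0 : Lat n) + x)
      have h2 : (1 : ℝ) ≤ (1 + ‖((0 : Lat n) : EuclideanSpace ℝ (Fin n)) + x‖) ^ (n + 1) :=
        one_le_pow₀ (by linarith [norm_nonneg (((0 : Lat n) : EuclideanSpace ℝ (Fin n)) + x)])
      have h3 := norm_nonneg (g (((0 : Lat n) : EuclideanSpace ℝ (Fin n)) + x))
      simp only [if_true]
      have : 0 ≤ C * (1 + R) ^ (n + 1) * ‖(0 : Lat n)‖⁻¹ ^ (n + 1) := by positivity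
      nlinarith
    · simp only [hl, if_false, add_zero]
      have hl' : 0 < ‖l‖ := norm_pos_iff.2 hl
      have h1 := hg (l + x)
      set y : EuclideanSpace ℝ (Fin n) := l + x with hy
      have h2 : ‖l‖ ≤ (1 + R) * (1 + ‖y‖) := by
        have : ‖l‖ ≤ ‖y‖ + ‖x‖ := by
          have := norm_sub_le y x
          simpa [hy] using this
        nlinarith [norm_nonneg y]
      have h3 : ‖l‖ ^ (n + 1) ≤ (1 + R) ^ (n + 1) * (1 + ‖y‖) ^ (n + 1) := by
        rw [← mul_pow]; exact pow_le_pow_left₀ hl'.le h2 _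
      rw [inv_pow, ← div_eq_mul_inv, le_div_iff₀ (by positivity)]
      calc ‖g y‖ * ‖l‖ ^ (n + 1) ≤ ‖g y‖ * ((1 + R) ^ (n + 1) * (1 + ‖y‖) ^ (n + 1)) := by gcongr
        _ = (‖g y‖ * (1 + ‖y‖) ^ (n + 1)) * (1 + R) ^ (n + 1) := by ring
        _ ≤ _ := by gcongr

lemma cell_norm {n : ℕ} : ∃ R : ℝ, 0 ≤ R ∧ ∀ x ∈ cell n, ‖x‖ ≤ R := by
  have := ZSpan.fundamentalDomain_isBounded (stdB n)
  rw [fd_eq] at this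
  obtain ⟨R, hR, h⟩ := this.exists_pos_norm_le
  exact ⟨R, hR.le, h⟩

lemma cell_meas (n : ℕ) : MeasurableSet (cell n) := by
  rw [← fd_eq]; exact ZSpan.fundamentalDomain_measurableSet _

lemma unfold_integral {n : ℕ} (g : EuclideanSpace ℝ (Fin n) → ℂ) (hgc : Continuous g) (C : ℝ)
    (hg : ∀ x, ‖g x‖ * (1 + ‖x‖) ^ (n + 1) ≤ C)
    (p : EuclideanSpace ℝ (Fin n) → ℂ) (hp : Measurable p)
    (hper : ∀ (x : EuclideanSpace ℝ (Fin n)) (l : Lat n), p (l + x) = p x)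
    (hint : IntegrableOn p (cell n)) :
    Integrable (fun x => p x * g x) ∧
    ∫ x, p x * g x = ∫ x in cell n, p x * ∑' l : Lat n, g (l + x) := by
  obtain ⟨R, hR, hcell⟩ := cell_norm (n := n)
  obtain ⟨B, hB0, hBs, hB⟩ := bound g C hg R hR
  have : VAddInvariantMeasure (Lat n) (EuclideanSpace ℝ (Fin n)) volume :=
    inferInstanceAs <| VAddInvariantMeasure (Lat n).toAddSubgroup (EuclideanSpace ℝ (Fin n)) volume
  have : MeasurableConstVAdd (Lat n) (EuclideanSpace ℝ (Fin n)) :=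
    inferInstanceAs <| MeasurableConstVAdd (Lat n).toAddSubgroup (EuclideanSpace ℝ (Fin n))
  have hpi : ∀ l : Lat n, IntegrableOn (fun x => p x * g (l + x)) (cell n) := by
    intro l
    refine Integrable.mono' (hint.norm.mul_const (B l)) ?_ ?_
    · exact (hp.mul (hgc.measurable.comp (measurable_const_add _))).aestronglyMeasurable
    · refine (ae_restrict_iff' (cell_meas n)).2 (.of_forall fun x hx => ?_)
      rw [norm_mul]
      gcongr
      exact hB l x (hcell x hx)
  have hI : Integrable (fun x => p x * g x) := by
    refine ⟨(hp.mul hgc.measurable).aestronglyMeasurable, ?_⟩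
    rw [HasFiniteIntegral, (isFD n).lintegral_eq_tsum'']
    calc ∑' l : Lat n, ∫⁻ x in cell n, ‖p (l +ᵥ x) * g (l +ᵥ x)‖ₑ
        ≤ ∑' l : Lat n, ENNReal.ofReal (B l) * ∫⁻ x in cell n, ‖p x‖ₑ := by
          refine ENNReal.tsum_le_tsum fun l => ?_
          rw [← lintegral_const_mul _ hp.enorm]
          refine setLIntegral_mono (hp.enorm.const_mul _) fun x hx => ?_
          have e : l +ᵥ x = (l : EuclideanSpace ℝ (Fin n)) + x := rfl
          rw [e, hper, enorm_mul, mul_comm]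
          gcongr
          rw [← ofReal_norm]
          exact ENNReal.ofReal_le_ofReal (hB l x (hcell x hx))
      _ = (∑' l : Lat n, ENNReal.ofReal (B l)) * ∫⁻ x in cell n, ‖p x‖ₑ := ENNReal.tsum_mul_right
      _ < ⊤ := by
          refine ENNReal.mul_lt_top ?_ hint.2
          rw [← ENNReal.ofReal_tsum_of_nonneg hB0 hBs]
          exact ENNReal.ofReal_lt_top
  refine ⟨hI, ?_⟩
  rw [(isFD n).integral_eq_tsum'' _ hI]
  have e : ∀ l : Lat n, ∫ x in cell n, p (l +ᵥ x) * g (l +ᵥ x) =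
      ∫ x in cell n, p x * g (l + x) := by
    intro l
    refine integral_congr_ae (.of_forall fun x => ?_)
    have e : l +ᵥ x = (l : EuclideanSpace ℝ (Fin n)) + x := rfl
    simp only [e, hper]
  rw [tsum_congr e, integral_tsum_of_summable_integral_norm hpi]
  · simp_rw [tsum_mul_left]
  · refine Summable.of_nonneg_of_le (fun l => by positivity) (fun l => ?_)
      (hBs.mul_left (∫ x in cell n, ‖p x‖))
    rw [← integral_mul_const]
    refine setIntegral_mono_on (hpi l).norm (hint.norm.mul_const _) (cell_meas n) fun x hx => ?_
    rw [norm_mul]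
    gcongr
    exact hB l x (hcell x hx)

lemma cont_tsum {n : ℕ} (g : EuclideanSpace ℝ (Fin n) → ℂ) (hgc : Continuous g) (C : ℝ)
    (hg : ∀ x, ‖g x‖ * (1 + ‖x‖) ^ (n + 1) ≤ C) :
    Continuous (fun x => ∑' l : Lat n, g (l + x)) := by
  rw [continuous_iff_continuousAt]
  intro x
  obtain ⟨B, hB0, hBs, hB⟩ := bound g C hg (‖x‖ + 1) (by positivity)
  have : ContinuousOn (fun x => ∑' l : Lat n, g (l + x)) (Metric.ball x 1) := by
    refine continuousOn_tsum (fun l => by fun_prop) hBs fun l y hy => hB l y ?_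
    have h1 := norm_sub_norm_le y x
    have h2 : ‖y - x‖ < 1 := by simpa [dist_eq_norm] using hy
    linarith
  exact this.continuousAt (Metric.ball_mem_nhds x one_pos)

lemma tsum_per {n : ℕ} (g : EuclideanSpace ℝ (Fin n) → ℂ) (k : Lat n)
    (x : EuclideanSpace ℝ (Fin n)) :
    ∑' l : Lat n, g (l + (k + x)) = ∑' l : Lat n, g (l + x) := by
  rw [← (Equiv.addRight k).tsum_eq (fun l : Lat n => g (l + x))]
  simp [add_assoc]

/-- The projection to the torus. -/
def proj {n : ℕ} (x : EuclideanSpace ℝ (Fin n)) : UnitAddTorus (Fin n) :=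
  fun i => ((x i : ℝ) : UnitAddCircle)

lemma proj_quot (n : ℕ) : IsOpenQuotientMap (proj (n := n)) := by
  have h1 : IsOpenQuotientMap (Pi.map (fun (_ : Fin n) (x : ℝ) => (x : UnitAddCircle))) :=
    IsOpenQuotientMap.piMap fun i => QuotientAddGroup.isOpenQuotientMap_mk
  exact h1.comp (EuclideanSpace.equiv (Fin n) ℝ).toHomeomorph.isOpenQuotientMap

lemma proj_eq {n : ℕ} {x y : EuclideanSpace ℝ (Fin n)} (h : proj x = proj y) :
    ∃ l : Lat n, x = (l : EuclideanSpace ℝ (Fin n)) + y := by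
  have : ∀ i, ∃ m : ℤ, x i = m + y i := by
    intro i
    have hi : ((x i : ℝ) : UnitAddCircle) = (y i : ℝ) := congrFun h i
    have h2 : ((x i - y i : ℝ) : UnitAddCircle) = 0 := by
      rw [AddCircle.coe_sub, hi, sub_self]
    obtain ⟨k, hk⟩ := (AddCircle.coe_eq_zero_iff 1).1 h2
    refine ⟨k, ?_⟩
    rw [zsmul_one] at hk
    linarith
  choose m hm using this
  refine ⟨⟨_, coord_lat m⟩, ?_⟩
  ext i
  simp [hm i]

lemma proj_add {n : ℕ} (l : Lat n) (x : EuclideanSpace ℝ (Fin n)) : 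
    proj ((l : EuclideanSpace ℝ (Fin n)) + x) = proj x := by
  obtain ⟨m, hm⟩ := lat_coord l
  rw [hm]
  funext i
  simp only [proj]
  have : ((m i : ℝ) : UnitAddCircle) = 0 := by
    rw [AddCircle.coe_eq_zero_iff]
    exact ⟨m i, by simp⟩
  simp [this]

lemma cell_integral {n : ℕ} (F : UnitAddTorus (Fin n) → ℂ) (m : Fin n → ℤ) :
    UnitAddTorus.mFourierCoeff F m =
      ∫ x in cell n, UnitAddTorus.mFourier (-m) (proj x) * F (proj x) := by
  rw [UnitAddTorus.mFourierCoeff_eq_integral F m 0]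
  have hmp := PiLp.volume_preserving_toLp (Fin n)
  rw [← hmp.setIntegral_preimage_emb (MeasurableEquiv.toLp 2 (Fin n → ℝ)).measurableEmbedding]
  have hs : ({x : Fin n → ℝ | ∀ i, x i ∈ Set.Ioc ((0 : Fin n → ℝ) i) ((0 : Fin n → ℝ) i + 1)}
      : Set (Fin n → ℝ)) =ᵐ[volume] (WithLp.toLp 2) ⁻¹' (cell n) := by
    have h1 := Measure.univ_pi_Ioc_ae_eq_Icc (μ := fun _ : Fin n => (volume : Measure ℝ))
      (f := fun _ => 0) (g := fun _ => 1)
    have h2 := Measure.univ_pi_Ico_ae_eq_Icc (μ := fun _ : Fin n => (volume : Measure ℝ))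
      (f := fun _ => 0) (g := fun _ => 1)
    have h3 := h1.trans h2.symm
    have e1 : ({x : Fin n → ℝ | ∀ i, x i ∈ Set.Ioc ((0 : Fin n → ℝ) i) ((0 : Fin n → ℝ) i + 1)}
        : Set (Fin n → ℝ)) = Set.univ.pi fun _ => Set.Ioc (0 : ℝ) 1 := by
      ext x; simp
    have e2 : (WithLp.toLp 2) ⁻¹' (cell n) = Set.univ.pi fun _ : Fin n => Set.Ico (0 : ℝ) 1 := by
      ext x; simp
    rw [e1, e2]
    exact h3
  rw [setIntegral_congr_set hs]
  rfl

lemma mFourier_proj {n : ℕ} (m : Fin n → ℤ) (x : EuclideanSpace ℝ (Fin n)) :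
    UnitAddTorus.mFourier (-m) (proj x) =
      Complex.exp (↑(-2 * Real.pi * ∑ i, x i * m i) * Complex.I) := by
  simp only [UnitAddTorus.mFourier, ContinuousMap.coe_mk, proj, fourier_coe_apply]
  rw [← Complex.exp_sum]
  congr 1
  push_cast
  rw [Finset.mul_sum, Finset.sum_mul]
  refine Finset.sum_congr rfl fun i _ => ?_
  simp
  ring

lemma tsum_const {n : ℕ} (g : EuclideanSpace ℝ (Fin n) → ℂ) (hgc : Continuous g) (C : ℝ)
    (hg : ∀ x, ‖g x‖ * (1 + ‖x‖) ^ (n + 1) ≤ C)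
    (h0 : ∀ m : Fin n → ℤ, m ≠ 0 →
      ∫ x, UnitAddTorus.mFourier (-m) (proj x) * g x = 0) (x : EuclideanSpace ℝ (Fin n)) :
    ∑' l : Lat n, g (l + x) = ∫ x, g x := by
  classical
  set Q : EuclideanSpace ℝ (Fin n) → ℂ := fun x => ∑' l : Lat n, g (l + x) with hQ
  have hQc : Continuous Q := cont_tsum g hgc C hg
  let F0 : UnitAddTorus (Fin n) → ℂ := fun t => Q (Function.surjInv (proj_quot n).surjective t)
  have hF0 : ∀ x, F0 (proj x) = Q x := by
    intro x
    obtain ⟨l, hl⟩ := proj_eq (Function.surjInv_eq (proj_quot n).surjective (proj x))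
    simp only [F0, hl]
    exact tsum_per g l x
  have hF0c : Continuous F0 := by
    rw [← (proj_quot n).continuous_comp_iff]
    exact hQc.congr fun x => (hF0 x).symm
  let F : C(UnitAddTorus (Fin n), ℂ) := ⟨F0, hF0c⟩
  have hcoef : ∀ m, UnitAddTorus.mFourierCoeff F m =
      ∫ x, UnitAddTorus.mFourier (-m) (proj x) * g x := by
    intro m
    have hc : Continuous fun x : EuclideanSpace ℝ (Fin n) =>
        UnitAddTorus.mFourier (-m) (proj x) :=
      (UnitAddTorus.mFourier (-m)).continuous.comp (proj_quot n).continuous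
    obtain ⟨R, hR, hcell⟩ := cell_norm (n := n)
    rw [cell_integral, (unfold_integral g hgc C hg _ hc.measurable (fun x l => by rw [proj_add])
      ?_).2]
    · exact integral_congr_ae (.of_forall fun x => by simp only [F, ContinuousMap.coe_mk, hF0, hQ])
    · exact (hc.continuousOn.integrableOn_compact (isCompact_closedBall 0 R)).mono_set
        fun x hx => by simpa using hcell x hx
  have hs : ∀ m ∉ ({0} : Finset (Fin n → ℤ)), UnitAddTorus.mFourierCoeff F m = 0 := by
    intro m hm
    rw [hcoef, h0 m (by simpa using hm)]
  have h1 := UnitAddTorus.hasSum_mFourier_series_apply_of_summable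
    (summable_of_ne_finset_zero hs) (proj x)
  have h2 := hasSum_sum_of_ne_finset_zero (L := .unconditional _) (s := {0})
    (f := fun i => UnitAddTorus.mFourierCoeff F i • UnitAddTorus.mFourier i (proj x))
    (fun m hm => by rw [hs m hm, zero_smul])
  have h3 := h1.unique h2
  rw [Finset.sum_singleton, hcoef, UnitAddTorus.mFourier_zero] at h3
  have h4 : F (proj x) = Q x := hF0 x
  rw [h4] at h3
  refine h3.trans ?_
  simp [UnitAddTorus.mFourier_zero]

end AvgLemma

/-- **Averaging lemma** (Lemma 6.3 of the paper, Lemma 4.5 of [Sagiv–Weinstein 2022]) for the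
lattice `ℤⁿ`: if `p` is `ℤⁿ`-periodic and integrable on the unit cell, and `q` is a Schwartz
function whose Fourier transform is supported in the closed ball of radius `d`, then for
`0 < ε` with `ε d < 1`,
`∫ p(x) q(εx) dx = ε^{-n} (∫_{cell} p) (∫ q)`. -/
theorem averaging_lemma
    {n : ℕ} (hn : 1 ≤ n)
    (p : EuclideanSpace ℝ (Fin n) → ℂ) (hp_meas : Measurable p)
    (hp_per : ∀ (x : EuclideanSpace ℝ (Fin n)) (m : Fin n → ℤ),
      p (x + (WithLp.equiv 2 (Fin n → ℝ)).symm (fun i => (m i : ℝ))) = p x)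
    (hp_int : IntegrableOn p {x : EuclideanSpace ℝ (Fin n) | ∀ i, x i ∈ Set.Ico (0 : ℝ) 1})
    (q : 𝓢(EuclideanSpace ℝ (Fin n), ℂ)) (d : ℝ) (hd : 0 < d)
    (hq_supp : ∀ ξ : EuclideanSpace ℝ (Fin n), d < ‖ξ‖ → 𝓕 (⇑q) ξ = 0)
    (ε : ℝ) (hε : 0 < ε) (hεd : ε * d < 1) :
    Integrable (fun x => p x * q (ε • x)) ∧
    ∫ x, p x * q (ε • x) =
      ((ε ^ n : ℝ) : ℂ)⁻¹ *
        (∫ x in {x : EuclideanSpace ℝ (Fin n) | ∀ i, x i ∈ Set.Ico (0 : ℝ) 1}, p x) *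
        (∫ X, q X) := by
  have hgc : Continuous fun x : EuclideanSpace ℝ (Fin n) => q (ε • x) :=
    q.continuous.comp (continuous_const_smul ε)
  obtain ⟨C, hC⟩ : ∃ C : ℝ, ∀ x : EuclideanSpace ℝ (Fin n),
      ‖q (ε • x)‖ * (1 + ‖x‖) ^ (n + 1) ≤ C := by
    obtain ⟨C0, hC0⟩ : ∃ C0 : ℝ, ∀ y, (1 + ‖y‖) ^ (n + 1) * ‖q y‖ ≤ C0 := by
      refine ⟨2 ^ (n + 1) * ((Finset.Iic (n + 1, 0)).sup
        fun m => SchwartzMap.seminorm ℝ m.1 m.2) q, fun y => ?_⟩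
      have := SchwartzMap.one_add_le_sup_seminorm_apply (𝕜 := ℝ) (m := (n + 1, 0))
        (k := n + 1) (n := 0) le_rfl le_rfl q y
      rw [norm_iteratedFDeriv_zero] at this
      exact this
    refine ⟨(1 + ε⁻¹) ^ (n + 1) * C0, fun x => ?_⟩
    have h1 : 1 + ‖x‖ ≤ (1 + ε⁻¹) * (1 + ‖ε • x‖) := by
      rw [norm_smul, Real.norm_of_nonneg hε.le]
      have h2 : ε⁻¹ * (ε * ‖x‖) = ‖x‖ := by field_simp
      have : 0 < ε⁻¹ := by positivity
      nlinarith [norm_nonneg x, mul_nonneg hε.le (norm_nonneg x)]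
    calc ‖q (ε • x)‖ * (1 + ‖x‖) ^ (n + 1)
        ≤ ‖q (ε • x)‖ * ((1 + ε⁻¹) * (1 + ‖ε • x‖)) ^ (n + 1) := by gcongr
      _ = (1 + ε⁻¹) ^ (n + 1) * ((1 + ‖ε • x‖) ^ (n + 1) * ‖q (ε • x)‖) := by
          rw [mul_pow]; ring
      _ ≤ _ := by gcongr; exact hC0 _
  have hper : ∀ (x : EuclideanSpace ℝ (Fin n)) (l : AvgLemma.Lat n), p (l + x) = p x := by
    intro x l
    obtain ⟨m, hm⟩ := AvgLemma.lat_coord l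
    rw [hm, add_comm, hp_per]
  obtain ⟨hI, hE⟩ := AvgLemma.unfold_integral _ hgc C hC p hp_meas hper hp_int
  refine ⟨hI, ?_⟩
  have hzero : ∀ m : Fin n → ℤ, m ≠ 0 →
      ∫ x : EuclideanSpace ℝ (Fin n),
        UnitAddTorus.mFourier (-m) (AvgLemma.proj x) * q (ε • x) = 0 := by
    intro m hm
    set v : EuclideanSpace ℝ (Fin n) := WithLp.toLp 2 (fun i => (m i : ℝ)) with hv
    have hv1 : 1 ≤ ‖v‖ := by
      obtain ⟨i, hi⟩ := Function.ne_iff.1 hm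
      have h1 : ‖v i‖ ≤ ‖v‖ := PiLp.norm_apply_le v i
      have h2 : (1 : ℝ) ≤ ‖v i‖ := by
        have : (1 : ℤ) ≤ |m i| := Int.one_le_abs hi
        have h : ((1 : ℤ) : ℝ) ≤ (|m i| : ℤ) := by exact_mod_cast this
        simpa [hv] using h
      linarith
    have hF := hq_supp (ε⁻¹ • v) (by
      rw [norm_smul, norm_inv, Real.norm_of_nonneg hε.le]
      have : d < ε⁻¹ := by rw [lt_inv_comm₀ hd hε, ← one_div, lt_div_iff₀ hd]; exact hεd
      have h5 : 0 < ε⁻¹ := by positivity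
      nlinarith)
    rw [Real.fourier_eq'] at hF
    have := Measure.integral_comp_smul (volume : Measure (EuclideanSpace ℝ (Fin n)))
      (fun y => Complex.exp (↑(-2 * Real.pi * inner ℝ y (ε⁻¹ • v)) * Complex.I) • q y) ε
    rw [hF, smul_zero] at this
    rw [← this]
    refine integral_congr_ae (.of_forall fun x => ?_)
    simp only [AvgLemma.mFourier_proj, smul_eq_mul]
    have h6 : inner ℝ (ε • x) (ε⁻¹ • v) = ∑ i, x i * m i := by
      rw [real_inner_smul_left, real_inner_smul_right, ← mul_assoc, mul_inv_cancel₀ hε.ne',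
        one_mul, PiLp.inner_apply]
      simp [hv, mul_comm]
    rw [h6]
  rw [hE]
  simp_rw [AvgLemma.tsum_const _ hgc C hC hzero]
  rw [integral_mul_const, Measure.integral_comp_smul]
  rw [abs_of_pos (by positivity), finrank_euclideanSpace_fin, Complex.real_smul]
  push_cast
  ring
end

section
/- Let n ≥ 1 and let q : ℝⁿ → ℂ be a Schwartz function whose Fourier transform 𝓕q vanishes outside the closed ball of radius d > 0 centered at the origin. Then for every ε with 0 < ε and ε·d < 1 and every y ∈ ℝⁿ, the periodization satisfies ∑_{m ∈ ℤⁿ} q(ε(y + m)) = ε^{−n} · ∫_{ℝⁿ} q(X) dX. -/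
open MeasureTheory FourierTransform
open scoped SchwartzMap

/-- integer vector as a real vector -/
def intVec {n : ℕ} (m : Fin n → ℤ) : Fin n → ℝ := fun i => (m i : ℝ)

lemma summable_intVec (n : ℕ) :
    Summable fun m : Fin n → ℤ => ((1 + ‖intVec m‖) ^ (n + 1))⁻¹ := by
  let L : Submodule ℤ (Fin n → ℝ) := Submodule.span ℤ (Set.range (Pi.basisFun ℝ (Fin n)))
  have hfr : Module.finrank ℤ L = n := by
    rw [ZLattice.rank ℝ L]; simp
  have hs := ZLattice.summable_norm_pow_inv L (n + 1) (by omega)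
  have hmem : ∀ m : Fin n → ℤ, intVec m ∈ L := by
    intro m
    rw [(Pi.basisFun ℝ (Fin n)).mem_span_iff_repr_mem ℤ]
    intro i
    exact ⟨m i, by simp [intVec]⟩
  have hinj : Function.Injective (fun m : Fin n → ℤ => (⟨intVec m, hmem m⟩ : L)) := by
    intro a b h
    have h2 : intVec a = intVec b := congrArg Subtype.val h
    ext i
    have h3 := congrFun h2 i
    simp only [intVec] at h3
    exact_mod_cast h3
  have hs2 := hs.comp_injective hinj
  refine Summable.of_norm_bounded_eventually hs2 ?_
  refine (Set.finite_singleton (0 : Fin n → ℤ)).subset ?_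
  intro m hm
  by_contra hne
  apply hm
  have hpos : 0 < ‖intVec m‖ := by
    rw [norm_pos_iff]
    intro h
    apply hne
    ext i
    have h3 := congrFun h i
    simp only [intVec, Pi.zero_apply] at h3
    exact_mod_cast h3
  change ‖((1 + ‖intVec m‖) ^ (n + 1))⁻¹‖ ≤ ‖intVec m‖⁻¹ ^ (n + 1)
  rw [Real.norm_of_nonneg (by positivity), inv_pow]
  gcongr
  linarith

section
variable {n : ℕ} {f : (Fin n → ℝ) → ℂ} {C : ℝ}

lemma term_bound (hb : ∀ x, ‖f x‖ ≤ C * ((1 + ‖x‖) ^ (n + 1))⁻¹)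
    (R : ℝ) (x : Fin n → ℝ) (hx : ‖x‖ ≤ R) (m : Fin n → ℤ) :
    ‖f (x + intVec m)‖ ≤ C * (1 + R) ^ (n + 1) * ((1 + ‖intVec m‖) ^ (n + 1))⁻¹ := by
  have hC : 0 ≤ C := by
    have := (norm_nonneg _).trans (hb 0)
    simpa using this
  have h0 := norm_nonneg x
  have h3 := norm_nonneg (x + intVec m)
  have h1 : ‖intVec m‖ ≤ ‖x + intVec m‖ + ‖x‖ := by
    simpa using norm_sub_le (x + intVec m) x
  have h2 : 1 + ‖intVec m‖ ≤ (1 + R) * (1 + ‖x + intVec m‖) := by nlinarith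
  refine (hb _).trans ?_
  rw [mul_assoc]
  gcongr
  rw [inv_le_iff_one_le_mul₀ (by positivity), mul_assoc, mul_comm (_⁻¹), ← mul_assoc, ← mul_pow,
    ← div_eq_mul_inv, one_le_div (by positivity)]
  gcongr

lemma per_summable (hb : ∀ x, ‖f x‖ ≤ C * ((1 + ‖x‖) ^ (n + 1))⁻¹) (x : Fin n → ℝ) :
    Summable fun m : Fin n → ℤ => f (x + intVec m) :=
  Summable.of_norm_bounded ((summable_intVec n).mul_left _) (term_bound hb ‖x‖ x le_rfl)

lemma per_continuous (hf : Continuous f) (hb : ∀ x, ‖f x‖ ≤ C * ((1 + ‖x‖) ^ (n + 1))⁻¹) :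
    Continuous fun x => ∑' m : Fin n → ℤ, f (x + intVec m) := by
  rw [continuous_iff_continuousAt]
  intro x
  have : ContinuousOn (fun x => ∑' m : Fin n → ℤ, f (x + intVec m)) (Metric.closedBall 0 (‖x‖ + 1)) := by
    refine continuousOn_tsum (fun m => by fun_prop) ((summable_intVec n).mul_left _)
      fun m y hy => term_bound hb (‖x‖ + 1) y (by simpa using hy) m
  refine this.continuousAt (Metric.closedBall_mem_nhds_of_mem ?_)
  simp

lemma per_periodic (x : Fin n → ℝ) (k : Fin n → ℤ) :
    ∑' m : Fin n → ℤ, f (x + intVec k + intVec m) = ∑' m : Fin n → ℤ, f (x + intVec m) := by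
  rw [← (Equiv.addLeft k).tsum_eq (fun m => f (x + intVec m))]
  refine tsum_congr fun m => ?_
  congr 1
  ext i
  simp [intVec, add_assoc]

lemma isOpenQuotientMap_torus :
    IsOpenQuotientMap (fun (x : Fin n → ℝ) => (fun i => (x i : UnitAddCircle) : UnitAddTorus (Fin n))) :=
  IsOpenQuotientMap.piMap (f := fun _ : Fin n => ((↑) : ℝ → UnitAddCircle))
    fun _ => QuotientAddGroup.isOpenQuotientMap_mk

lemma per_descend (hf : Continuous f) (hb : ∀ x, ‖f x‖ ≤ C * ((1 + ‖x‖) ^ (n + 1))⁻¹) :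
    ∃ F : C(UnitAddTorus (Fin n), ℂ), ∀ x : Fin n → ℝ,
      F (fun i => (x i : UnitAddCircle)) = ∑' m : Fin n → ℤ, f (x + intVec m) := by
  have hq := isOpenQuotientMap_torus (n := n)
  let s := Function.surjInv hq.surjective
  have hs : ∀ t, (fun i => ((s t i : ℝ) : UnitAddCircle)) = t := Function.surjInv_eq hq.surjective
  have key : ∀ x : Fin n → ℝ,
      ∑' m : Fin n → ℤ, f (s (fun i => (x i : UnitAddCircle)) + intVec m) =
      ∑' m : Fin n → ℤ, f (x + intVec m) := by
    intro x
    have h := hs (fun i => (x i : UnitAddCircle))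
    have h2 : ∀ i, ∃ k : ℤ, s (fun i => (x i : UnitAddCircle)) i = x i + k := by
      intro i
      obtain ⟨k, hk⟩ := (QuotientAddGroup.eq_iff_sub_mem.mp (congrFun h i))
      refine ⟨k, ?_⟩
      simp at hk
      linarith
    choose k hk using h2
    have : s (fun i => (x i : UnitAddCircle)) = x + intVec k := by
      ext i; simpa [intVec] using hk i
    rw [this, per_periodic]
  refine ⟨⟨fun t => ∑' m : Fin n → ℤ, f (s t + intVec m), ?_⟩, key⟩
  rw [← hq.continuous_comp_iff]
  exact (per_continuous hf hb).congr fun x => (key x).symm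

/-- unfolding of the integral over the unit cube -/
lemma unfold_integral {g : (Fin n → ℝ) → ℂ} (hg : Integrable g) :
    ∫ x in {x : Fin n → ℝ | ∀ i, x i ∈ Set.Ioc ((0 : Fin n → ℝ) i) ((0 : Fin n → ℝ) i + 1)},
      ∑' m : Fin n → ℤ, g (x + intVec m) = ∫ x, g x := by
  set Q : Set (Fin n → ℝ) :=
    {x : Fin n → ℝ | ∀ i, x i ∈ Set.Ioc ((0 : Fin n → ℝ) i) ((0 : Fin n → ℝ) i + 1)} with hQ
  have hQm : MeasurableSet Q := MeasurableSet.univ_pi' (fun i => measurableSet_Ioc)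
  let S : (Fin n → ℤ) → Set (Fin n → ℝ) := fun m => (fun x => x + intVec (-m)) ⁻¹' Q
  have hSm : ∀ m, MeasurableSet (S m) := fun m => (measurable_add_const _) hQm
  have hmemS : ∀ m x, x ∈ S m ↔ ∀ i, m i = ⌈x i⌉ - 1 := by
    intro m x
    refine forall_congr' fun i => ?_
    have : (m i = ⌈x i⌉ - 1) ↔ ⌈x i⌉ = m i + 1 := by omega
    rw [this, Int.ceil_eq_iff]
    simp only [Pi.add_apply, intVec, Pi.neg_apply, Pi.zero_apply, Set.mem_Ioc]
    push_cast
    constructor <;> rintro ⟨h1, h2⟩ <;> constructor <;> linarith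
  have hdisj : Pairwise (Function.onFun Disjoint S) := by
    intro a b hab
    refine Set.disjoint_left.mpr fun x ha hb => hab ?_
    ext i
    rw [(hmemS a x).1 ha i, (hmemS b x).1 hb i]
  have hU : ⋃ m, S m = Set.univ := by
    ext x
    simp only [Set.mem_iUnion, Set.mem_univ, iff_true]
    exact ⟨fun i => ⌈x i⌉ - 1, (hmemS _ x).2 fun i => rfl⟩
  have trans : ∀ {E : Type} [NormedAddCommGroup E] [NormedSpace ℝ E] (h : (Fin n → ℝ) → E)
      (m : Fin n → ℤ), ∫ x in S m, h x = ∫ x in Q, h (x + intVec m) := by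
    intro E _ _ h m
    have mp := measurePreserving_add_right (volume : Measure (Fin n → ℝ)) (intVec (-m))
    have := mp.setIntegral_preimage_emb (measurableEmbedding_addRight _)
      (fun x => h (x + intVec m)) Q
    rw [← this]
    refine setIntegral_congr_fun (hSm m) fun x _ => ?_
    congr 1
    ext i
    simp [intVec]
  have h1 := hasSum_integral_iUnion hSm hdisj (f := g) (μ := volume) hg.integrableOn
  have h2 := hasSum_integral_iUnion hSm hdisj (f := fun x => ‖g x‖) (μ := volume)
    hg.norm.integrableOn
  rw [hU, setIntegral_univ] at h1 h2
  simp only [trans] at h1 h2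
  rw [← h1.tsum_eq]
  symm
  exact integral_tsum_of_summable_integral_norm
    (fun m => (hg.comp_add_right (intVec m)).integrableOn) h2.summable

lemma coeff_eq (hfi : Integrable f) (F : C(UnitAddTorus (Fin n), ℂ))
    (hF : ∀ x : Fin n → ℝ,
      F (fun i => (x i : UnitAddCircle)) = ∑' m : Fin n → ℤ, f (x + intVec m)) (k : Fin n → ℤ) :
    UnitAddTorus.mFourierCoeff F k =
      ∫ x : Fin n → ℝ, Complex.exp (-(2 * Real.pi * (∑ i, x i * k i : ℝ)) * Complex.I) * f x := by
  have hexp : ∀ x : Fin n → ℝ, UnitAddTorus.mFourier (-k) (fun i => (x i : UnitAddCircle)) =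
      Complex.exp (-(2 * Real.pi * (∑ i, x i * k i : ℝ)) * Complex.I) := by
    intro x
    simp only [UnitAddTorus.mFourier, ContinuousMap.coe_mk, fourier_coe_apply, ← Complex.exp_sum]
    congr 1
    push_cast
    rw [Finset.mul_sum, ← Finset.sum_neg_distrib, Finset.sum_mul]
    refine Finset.sum_congr rfl fun i _ => ?_
    simp
    ring
  have hper : ∀ (x : Fin n → ℝ) (m : Fin n → ℤ),
      (fun i => ((x + intVec m) i : UnitAddCircle)) = (fun i => (x i : UnitAddCircle)) := by
    intro x m
    ext i
    simp [intVec]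
  rw [UnitAddTorus.mFourierCoeff_eq_integral F k 0, ← unfold_integral]
  · congr 1
    ext x
    rw [hF, smul_eq_mul, ← tsum_mul_left]
    refine tsum_congr fun m => ?_
    rw [← hexp (x + intVec m), hper]
  · refine hfi.bdd_mul (c := 1) (Continuous.aestronglyMeasurable (by fun_prop)) (Filter.Eventually.of_forall fun x => ?_)
    rw [← hexp]
    refine (ContinuousMap.norm_coe_le_norm _ _).trans ?_
    rw [UnitAddTorus.mFourier_norm]
end

theorem periodization_bandlimited
    {n : ℕ} (hn : 1 ≤ n)
    (q : 𝓢(EuclideanSpace ℝ (Fin n), ℂ)) (d : ℝ) (hd : 0 < d)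
    (hq_supp : ∀ ξ : EuclideanSpace ℝ (Fin n), d < ‖ξ‖ → 𝓕 (⇑q) ξ = 0)
    (ε : ℝ) (hε : 0 < ε) (hεd : ε * d < 1) :
    ∀ y : EuclideanSpace ℝ (Fin n),
      ∑' m : Fin n → ℤ,
          q (ε • (y + (WithLp.equiv 2 (Fin n → ℝ)).symm (fun i => (m i : ℝ)))) =
        ((ε ^ n : ℝ) : ℂ)⁻¹ * ∫ X, q X := by
  intro y
  let f : (Fin n → ℝ) → ℂ := fun x => q (ε • WithLp.toLp 2 x)
  have hfc : Continuous f := by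
    have := q.continuous
    fun_prop
  -- integrability
  have hint : Integrable (fun X => q (ε • X)) := q.integrable.comp_smul hε.ne'
  have hfi : Integrable f :=
    ((PiLp.volume_preserving_toLp (Fin n)).integrable_comp_emb
      (MeasurableEquiv.toLp 2 _).measurableEmbedding).2 hint
  -- decay
  obtain ⟨C, hb⟩ : ∃ C, ∀ x, ‖f x‖ ≤ C * ((1 + ‖x‖) ^ (n + 1))⁻¹ := by
    obtain ⟨C, hC⟩ : ∃ C, ∀ X, (1 + ‖X‖) ^ (n + 1) * ‖q X‖ ≤ C := by
      have h := SchwartzMap.one_add_le_sup_seminorm_apply (𝕜 := ℝ) (m := (n + 1, 0))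
        (k := n + 1) (n := 0) le_rfl le_rfl q
      simp only [norm_iteratedFDeriv_zero] at h
      exact ⟨_, h⟩
    refine ⟨C * (1 + ε⁻¹) ^ (n + 1), fun x => ?_⟩
    have h1 : ‖x‖ ≤ ‖WithLp.toLp 2 x‖ := by
      rw [pi_norm_le_iff_of_nonneg (norm_nonneg _)]
      intro i
      exact PiLp.norm_apply_le (WithLp.toLp 2 x) i
    have h2 : ‖ε • WithLp.toLp 2 x‖ = ε * ‖WithLp.toLp 2 x‖ := by
      rw [norm_smul, Real.norm_of_nonneg hε.le]
    have h3 : 1 + ‖x‖ ≤ (1 + ε⁻¹) * (1 + ‖ε • WithLp.toLp 2 x‖) := by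
      rw [h2]
      have : (1 + ε⁻¹) * (1 + ε * ‖WithLp.toLp 2 x‖) =
        1 + ε⁻¹ + ε * ‖WithLp.toLp 2 x‖ + ‖WithLp.toLp 2 x‖ := by field_simp; ring
      rw [this]
      have : 0 ≤ ε⁻¹ + ε * ‖WithLp.toLp 2 x‖ := by positivity
      linarith
    rw [← div_eq_mul_inv, le_div_iff₀ (by positivity)]
    calc ‖f x‖ * (1 + ‖x‖) ^ (n + 1)
        ≤ ‖f x‖ * ((1 + ε⁻¹) * (1 + ‖ε • WithLp.toLp 2 x‖)) ^ (n + 1) := by gcongr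
      _ = ((1 + ‖ε • WithLp.toLp 2 x‖) ^ (n + 1) * ‖f x‖) * (1 + ε⁻¹) ^ (n + 1) := by
        rw [mul_pow]; ring
      _ ≤ _ := by gcongr; exact hC _
  obtain ⟨F, hF⟩ := per_descend hfc hb
  -- coefficients
  have hcoef : ∀ k : Fin n → ℤ, UnitAddTorus.mFourierCoeff F k =
      ((ε ^ n : ℝ) : ℂ)⁻¹ * 𝓕 (⇑q) (ε⁻¹ • WithLp.toLp 2 (intVec k)) := by
    intro k
    rw [coeff_eq hfi F hF k, Real.fourier_eq']
    have h1 := (PiLp.volume_preserving_toLp (Fin n)).integral_comp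
      (MeasurableEquiv.toLp 2 _).measurableEmbedding
      (fun X : EuclideanSpace ℝ (Fin n) =>
        Complex.exp (-(2 * Real.pi * (∑ i, X i * k i : ℝ)) * Complex.I) * q (ε • X))
    have h2 := Measure.integral_comp_smul (volume : Measure (EuclideanSpace ℝ (Fin n)))
      (fun v => Complex.exp (↑(-2 * Real.pi * inner ℝ v (ε⁻¹ • WithLp.toLp 2 (intVec k))) * Complex.I)
        • q v) ε
    refine h1.trans (Eq.trans ?_ (h2.trans ?_))
    · congr 1
      ext X
      rw [real_inner_smul_left, real_inner_smul_right, smul_eq_mul, mul_inv_cancel_left₀ hε.ne']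
      congr 2
      simp [PiLp.inner_apply, intVec, mul_comm]
    · rw [finrank_euclideanSpace_fin, abs_of_pos (by positivity), Complex.real_smul]
      simp
  have hzero : ∀ k : Fin n → ℤ, k ≠ 0 → UnitAddTorus.mFourierCoeff F k = 0 := by
    intro k hk
    rw [hcoef, hq_supp, mul_zero]
    obtain ⟨i, hi⟩ := Function.ne_iff.mp hk
    have h1 : (1 : ℝ) ≤ ‖WithLp.toLp 2 (intVec k)‖ := by
      refine le_trans ?_ (PiLp.norm_apply_le (WithLp.toLp 2 (intVec k)) i)
      simp only [intVec, Real.norm_eq_abs]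
      exact_mod_cast Int.one_le_abs hi
    rw [norm_smul, Real.norm_of_nonneg (by positivity)]
    calc d < ε⁻¹ := by rw [lt_inv_comm₀ hd hε, ← one_div, lt_div_iff₀ hd]; exact hεd
      _ ≤ _ := le_mul_of_one_le_right (by positivity) h1
  have hsum : Summable (UnitAddTorus.mFourierCoeff F) :=
    summable_of_ne_finset_zero (s := {0}) fun k hk => hzero k (by simpa using hk)
  have h := UnitAddTorus.hasSum_mFourier_series_apply_of_summable hsum (fun i => (y i : UnitAddCircle))
  have h' := h.unique (hasSum_single (0 : Fin n → ℤ) fun k hk => by rw [hzero k hk, zero_smul])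
  rw [hF, hcoef, UnitAddTorus.mFourier_zero] at h'
  have h0 : 𝓕 (⇑q) (ε⁻¹ • WithLp.toLp 2 (intVec (0 : Fin n → ℤ))) = ∫ X, q X := by
    have : WithLp.toLp 2 (intVec (0 : Fin n → ℤ)) = 0 := by
      ext i; simp [intVec]
    rw [this, smul_zero, Real.fourier_eq']
    simp
  rw [h0] at h'
  rw [ContinuousMap.one_apply, smul_eq_mul, mul_one] at h'
  exact h'
end

section
/- Let n, N ≥ 1. For each j ∈ {1,…,N} let p_j : ℝⁿ → ℂ be measurable and ℤⁿ-periodic, square-integrable on the unit cell [0,1)ⁿ, and suppose the family is orthonormal over the cell: ∫_{[0,1)ⁿ} conj(p_j(x))·p_m(x) dx = 1 if j = m and 0 otherwise. For each j let γ_j : ℝⁿ → ℂ be a Schwartz function whose Fourier transform 𝓕γ_j vanishes outside the closed ball of radius d > 0 centered at the origin. Then for every ε with 0 < ε and 2·ε·d < 1, the function x ↦ |∑_{j=1}^N γ_j(ε x)·p_j(x)|² is integrable on ℝⁿ and ∫_{ℝⁿ} |∑_{j=1}^N γ_j(ε x)·p_j(x)|² dx = ε^{−n} · ∑_{j=1}^N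 ∫_{ℝⁿ} |γ_j(X)|² dX. -/
open MeasureTheory FourierTransform
open scoped SchwartzMap ComplexConjugate

namespace BLW
variable {n : ℕ}

/-- integer lattice vector -/
noncomputable def lat (m : Fin n → ℤ) : EuclideanSpace ℝ (Fin n) :=
  (WithLp.equiv 2 (Fin n → ℝ)).symm (fun i => (m i : ℝ))

/-- the unit cell -/
def cell (n : ℕ) : Set (EuclideanSpace ℝ (Fin n)) :=
  {x : EuclideanSpace ℝ (Fin n) | ∀ i, x i ∈ Set.Ico (0 : ℝ) 1}

@[simp] lemma lat_apply (m : Fin n → ℤ) (i : Fin n) : lat m i = m i := rfl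

lemma lat_add (m k : Fin n → ℤ) : lat (m + k) = lat m + lat k := by
  ext i; simp

lemma measurableSet_cell : MeasurableSet (cell n) := by
  have : cell n = ⋂ i, (fun x : EuclideanSpace ℝ (Fin n) => x i) ⁻¹' (Set.Ico (0:ℝ) 1) := by
    ext x; simp [cell]
  rw [this]
  exact MeasurableSet.iInter fun i => (by fun_prop : Measurable (fun x : EuclideanSpace ℝ (Fin n) => x i)) measurableSet_Ico

lemma volume_cell : volume (cell n) = 1 := by
  rw [← (PiLp.volume_preserving_toLp (Fin n)).measure_preimage measurableSet_cell.nullMeasurableSet]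
  have : (WithLp.toLp 2) ⁻¹' (cell n) = Set.pi Set.univ (fun _ : Fin n => Set.Ico (0:ℝ) 1) := by
    ext x; simp [cell]
  rw [this, volume_pi_pi]
  simp

instance : IsProbabilityMeasure (volume.restrict (cell n)) := ⟨by simp [volume_cell]⟩

lemma unfold_mp : MeasurePreserving (fun q : (Fin n → ℤ) × EuclideanSpace ℝ (Fin n) => q.2 + lat q.1)
    (Measure.count.prod (volume.restrict (cell n))) volume := by
  have hm : Measurable (fun q : (Fin n → ℤ) × EuclideanSpace ℝ (Fin n) => q.2 + lat q.1) := by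
    have : Measurable (lat : (Fin n → ℤ) → EuclideanSpace ℝ (Fin n)) := measurable_of_countable _
    fun_prop
  refine ⟨hm, ?_⟩
  ext s hs
  rw [Measure.map_apply hm hs, Measure.prod_apply (hm hs), lintegral_count]
  have hU : s = ⋃ k : Fin n → ℤ, (s ∩ {x | x - lat k ∈ cell n}) := by
    ext x
    simp only [Set.mem_iUnion, Set.mem_inter_iff, Set.mem_ofPred_eq, exists_and_left]
    refine ⟨fun h => ⟨h, fun i => ⌊x i⌋, fun i => ?_⟩, fun h => h.1⟩
    simp only [PiLp.sub_apply, lat_apply, Set.mem_Ico]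
    exact ⟨Int.fract_nonneg (x i), Int.fract_lt_one (x i)⟩
  have hmk : ∀ k : Fin n → ℤ, MeasurableSet {x | x - lat k ∈ cell n} := fun k =>
    (measurable_id.sub_const (lat k)) measurableSet_cell
  conv_rhs => rw [hU]
  rw [measure_iUnion]
  · congr 1
    ext k
    have h1 : MeasurableSet ((fun x => x + lat k) ⁻¹' s) := (measurable_id.add_const (lat k)) hs
    change (volume.restrict (cell n)) ((fun x => x + lat k) ⁻¹' s) = _
    rw [Measure.restrict_apply h1, ← measure_preimage_add_right volume (lat k) (s ∩ _)]
    congr 1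
    ext x
    simp
  · intro k l hkl
    refine Set.disjoint_left.2 ?_
    rintro x ⟨_, hx⟩ ⟨_, hy⟩
    apply hkl
    ext i
    have h1 := hx i
    have h2 := hy i
    simp only [PiLp.sub_apply, lat_apply, Set.mem_Ico] at h1 h2
    have a1 : ⌊x i⌋ = k i := Int.floor_eq_iff.2 ⟨by linarith, by linarith⟩
    have a2 : ⌊x i⌋ = l i := Int.floor_eq_iff.2 ⟨by linarith, by linarith⟩
    omega
  · exact fun k => hs.inter (hmk k)

/-- weight -/
noncomputable def wt (x : EuclideanSpace ℝ (Fin n)) : ℝ := ((1 + ‖x‖) ^ (n + 1))⁻¹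

lemma wt_pos (x : EuclideanSpace ℝ (Fin n)) : 0 < wt x := by unfold wt; positivity

lemma wt_cont : Continuous (wt : EuclideanSpace ℝ (Fin n) → ℝ) := by
  unfold wt
  refine Continuous.inv₀ (by fun_prop) (fun x => by positivity)

lemma wt_integrable : Integrable (wt : EuclideanSpace ℝ (Fin n) → ℝ) := by
  have := integrable_one_add_norm (E := EuclideanSpace ℝ (Fin n)) (μ := volume) (r := (n + 1 : ℕ))
    (by simp)
  refine this.congr (.of_forall fun x => ?_)
  simp only [wt]
  rw [Real.rpow_neg (by positivity), Real.rpow_natCast]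

lemma cell_norm {x : EuclideanSpace ℝ (Fin n)} (hx : x ∈ cell n) : ‖x‖ ≤ n := by
  have : ‖x‖ ^ 2 ≤ (n : ℝ) ^ 2 := by
    rw [EuclideanSpace.norm_sq_eq]
    calc ∑ i, ‖x i‖ ^ 2 ≤ ∑ i : Fin n, (1:ℝ) := by
          refine Finset.sum_le_sum fun i _ => ?_
          have := hx i
          rw [Real.norm_eq_abs, abs_of_nonneg this.1]
          nlinarith [this.1, this.2]
      _ = n := by simp
      _ ≤ (n:ℝ) ^ 2 := by
        norm_cast
        nlinarith [Nat.le_self_pow (two_ne_zero) n]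
  exact le_of_sq_le_sq this (by positivity)

lemma wt_le {x y k : EuclideanSpace ℝ (Fin n)} (hx : x ∈ cell n) (hy : y ∈ cell n) :
    wt (x + k) ≤ (1 + 2 * n) ^ (n + 1) * wt (y + k) := by
  unfold wt
  have h : 1 + ‖y + k‖ ≤ (1 + 2 * n) * (1 + ‖x + k‖) := by
    have : ‖y + k‖ ≤ ‖x + k‖ + ‖y‖ + ‖x‖ := by
      calc ‖y + k‖ = ‖(x + k) + y - x‖ := by congr 1; abel
        _ ≤ _ := (norm_sub_le _ _).trans (by gcongr; exact norm_add_le _ _)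
    have h1 := cell_norm hx
    have h2 := cell_norm hy
    have : 0 ≤ (n:ℝ) * ‖x + k‖ := by positivity
    nlinarith
  have h' : (1 + ‖y + k‖) ^ (n+1) ≤ (1 + 2 * n) ^ (n+1) * (1 + ‖x + k‖) ^ (n+1) := by
    rw [← mul_pow]; gcongr
  rw [inv_le_iff_one_le_mul₀ (by positivity), mul_assoc, mul_comm, mul_assoc, ← div_eq_inv_mul,
    le_div_iff₀ (by positivity)]
  linarith

lemma exists_bound {G : EuclideanSpace ℝ (Fin n) → ℂ} {C : ℝ} (hG : ∀ x, ‖G x‖ ≤ C * wt x) :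
    ∃ b : (Fin n → ℤ) → ℝ, Integrable b Measure.count ∧ ∀ x ∈ cell n, ∀ k, ‖G (x + lat k)‖ ≤ b k := by
  have hC : 0 ≤ C := by
    have := (norm_nonneg _).trans (hG 0)
    exact nonneg_of_mul_nonneg_left this (wt_pos 0)
  have h1 := (unfold_mp (n := n)).integrable_comp_of_integrable wt_integrable
  have h2 := h1.integral_prod_left
  refine ⟨_, h2.const_mul (C * (1 + 2 * n) ^ (n + 1)), fun x hx k => ?_⟩
  have h3 : wt (x + lat k) ≤ ∫ y in cell n, (1 + 2 * n) ^ (n + 1) * wt (y + lat k) := by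
    calc wt (x + lat k) = ∫ y in cell n, wt (x + lat k) := by simp [Measure.real]
      _ ≤ _ := by
        refine setIntegral_mono_on (integrable_const _) ?_ measurableSet_cell (fun y hy => wt_le hx hy)
        exact ((wt_integrable.comp_add_right (lat k)).const_mul _).integrableOn
  rw [integral_const_mul] at h3
  calc _ ≤ _ := hG _
    _ ≤ _ := mul_le_mul_of_nonneg_left h3 hC
    _ = _ := by simp [mul_assoc]

lemma integrable_unfold {G : EuclideanSpace ℝ (Fin n) → ℂ} {C : ℝ} (hG : ∀ x, ‖G x‖ ≤ C * wt x)
    (hGc : Continuous G) {a : EuclideanSpace ℝ (Fin n) → ℂ} (ham : Measurable a)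
    (hap : ∀ x m, a (x + lat m) = a x) (hai : IntegrableOn a (cell n)) :
    Integrable (fun x => G x * a x) ∧
      ∫ x, G x * a x = ∫ x in cell n, (∫ k, G (x + lat k) ∂Measure.count) * a x := by
  obtain ⟨b, hb, hGb⟩ := exists_bound hG
  have hmp := unfold_mp (n := n)
  have hmeas : Measurable (fun x => G x * a x) := hGc.measurable.mul ham
  have hI : Integrable (fun q : (Fin n → ℤ) × EuclideanSpace ℝ (Fin n) =>
      (fun x => G x * a x) (q.2 + lat q.1)) (Measure.count.prod (volume.restrict (cell n))) := by
    refine (hb.mul_prod hai.norm).mono (hmeas.comp hmp.measurable).aestronglyMeasurable ?_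
    have : ∀ᵐ q ∂((Measure.count : Measure (Fin n → ℤ)).prod (volume.restrict (cell n))), q.2 ∈ cell n :=
      Measure.quasiMeasurePreserving_snd.ae (ae_restrict_mem measurableSet_cell)
    filter_upwards [this] with q hq
    simp only [hap, norm_mul, norm_norm]
    gcongr
    exact (hGb _ hq _).trans (le_abs_self _)
  refine ⟨(hmp.integrable_comp hmeas.aestronglyMeasurable).1 hI, ?_⟩
  have h1 : ∫ x, G x * a x = ∫ q, (fun x => G x * a x) (q.2 + lat q.1)
      ∂((Measure.count : Measure (Fin n → ℤ)).prod (volume.restrict (cell n))) := by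
    conv_lhs => rw [← hmp.map_eq]
    exact integral_map hmp.measurable.aemeasurable hmeas.aestronglyMeasurable
  rw [h1, integral_prod_symm _ hI]
  simp only [hap, integral_mul_const]

attribute [local instance] instMeasureSpaceUnitAddCircle

lemma volume_circle : (volume : Measure UnitAddCircle) =
    (AddCircle.measureSpace 1).volume := by
  change AddCircle.haarAddCircle = _
  rw [AddCircle.volume_eq_smul_haarAddCircle]
  simp

instance : IsProbabilityMeasure (volume : Measure UnitAddCircle) :=
  inferInstanceAs (IsProbabilityMeasure AddCircle.haarAddCircle)

/-- projection to the torus -/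
def tor (x : EuclideanSpace ℝ (Fin n)) : UnitAddTorus (Fin n) := fun i => (x i : UnitAddCircle)

lemma tor_mp : MeasurePreserving (tor (n := n)) (volume.restrict (cell n)) volume := by
  have h1 : MeasurePreserving (WithLp.ofLp : EuclideanSpace ℝ (Fin n) → (Fin n → ℝ))
      (volume.restrict (cell n)) (volume.restrict (Set.pi Set.univ (fun _ : Fin n => Set.Ico (0:ℝ) 1))) := by
    have := (PiLp.volume_preserving_ofLp (Fin n)).restrict_preimage
      (s := Set.pi Set.univ (fun _ : Fin n => Set.Ico (0:ℝ) 1))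
      (MeasurableSet.univ_pi fun _ => measurableSet_Ico)
    have hc : (WithLp.ofLp : EuclideanSpace ℝ (Fin n) → (Fin n → ℝ)) ⁻¹'
        (Set.pi Set.univ (fun _ : Fin n => Set.Ico (0:ℝ) 1)) = cell n := by
      ext x; simp [cell]
    rw [hc] at this
    exact this
  have h2 : MeasurePreserving (fun (x : Fin n → ℝ) => (fun i => (x i : UnitAddCircle)))
      (volume.restrict (Set.pi Set.univ (fun _ : Fin n => Set.Ico (0:ℝ) 1)))
      (volume : Measure (UnitAddTorus (Fin n))) := by
    have h0 : MeasurePreserving (fun x : ℝ => (x : UnitAddCircle))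
        (volume.restrict (Set.Ico (0:ℝ) 1)) volume := by
      have := AddCircle.measurePreserving_mk 1 0
      rw [zero_add, ← Measure.restrict_congr_set (Ico_ae_eq_Ioc (a := (0:ℝ)) (b := 1))] at this
      rw [volume_circle]
      exact this
    rw [volume_pi, Measure.restrict_pi_pi]
    exact measurePreserving_pi _ _ (fun i : Fin n => h0)
  exact h2.comp h1

/-- a measurable section of `tor` -/
noncomputable def lift (t : UnitAddTorus (Fin n)) : EuclideanSpace ℝ (Fin n) :=
  WithLp.toLp 2 (fun i => (AddCircle.measurableEquivIoc 1 0 (t i) : ℝ))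

lemma lift_measurable : Measurable (lift (n := n)) := by
  unfold lift
  refine (WithLp.measurable_toLp _ _).comp (measurable_pi_lambda _ fun i => ?_)
  exact measurable_subtype_coe.comp ((AddCircle.measurableEquivIoc 1 0).measurable.comp (measurable_pi_apply i))

lemma lift_tor (x : EuclideanSpace ℝ (Fin n)) : ∃ m : Fin n → ℤ, lift (tor x) = x + lat m := by
  have : ∀ i, ∃ m : ℤ, lift (tor x) i = x i + m := by
    intro i
    have h : ((lift (tor x) i : ℝ) : UnitAddCircle) = (x i : UnitAddCircle) :=
      (AddCircle.measurableEquivIoc 1 0).symm_apply_apply (x i : UnitAddCircle)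
    rw [eq_comm, QuotientAddGroup.eq, AddSubgroup.mem_zmultiples_iff] at h
    obtain ⟨m, hm⟩ := h
    refine ⟨m, ?_⟩
    simp at hm
    linarith
  choose m hm using this
  exact ⟨m, by ext i; simp [hm]⟩

lemma mFourier_tor (m : Fin n → ℤ) (x : EuclideanSpace ℝ (Fin n)) :
    UnitAddTorus.mFourier (-m) (tor x) = (Real.fourierChar (-inner ℝ x (lat m)) : ℂ) := by
  simp only [UnitAddTorus.mFourier, tor, ContinuousMap.coe_mk, fourier_coe_apply,
    Real.fourierChar_apply, ← Complex.exp_sum, PiLp.inner_apply]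
  congr 1
  simp [Finset.mul_sum, Finset.sum_mul]
  refine Finset.sum_congr rfl fun i _ => by ring

lemma inner_lat_int (m k : Fin n → ℤ) : ∃ z : ℤ, inner ℝ (lat k) (lat m) = (z : ℝ) :=
  ⟨∑ i, m i * k i, by simp [PiLp.inner_apply]⟩

lemma periodize_ae {G : EuclideanSpace ℝ (Fin n) → ℂ} {C : ℝ} (hG : ∀ x, ‖G x‖ ≤ C * wt x)
    (hGc : Continuous G) (hF : ∀ m : Fin n → ℤ, m ≠ 0 → 𝓕 G (lat m) = 0) :
    ∀ᵐ x ∂(volume.restrict (cell n)), ∫ k, G (x + lat k) ∂Measure.count = ∫ x, G x := by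
  set S : EuclideanSpace ℝ (Fin n) → ℂ := fun x => ∫ k, G (x + lat k) ∂Measure.count with hS
  obtain ⟨b, hb, hGb⟩ := exists_bound hG
  have hSper : ∀ x m, S (x + lat m) = S x := by
    intro x m
    simp only [hS]
    rw [← integral_add_left_eq_self (fun k => G (x + lat k)) m]
    simp only [lat_add, add_assoc]
  have hSm : StronglyMeasurable S := by
    have hm : Measurable (fun q : EuclideanSpace ℝ (Fin n) × (Fin n → ℤ) => G (q.1 + lat q.2)) := by
      have : Measurable (lat : (Fin n → ℤ) → EuclideanSpace ℝ (Fin n)) := measurable_of_countable _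
      have := hGc.measurable
      fun_prop
    exact hm.stronglyMeasurable.integral_prod_right
  have hSb : ∀ x ∈ cell n, ‖S x‖ ≤ ∫ k, b k ∂Measure.count := fun x hx =>
    norm_integral_le_of_norm_le hb (.of_forall fun k => hGb x hx k)
  have hmp := tor_mp (n := n)
  let F : UnitAddTorus (Fin n) → ℂ := fun t => S (lift t)
  have hFT : ∀ x, F (tor x) = S x := by
    intro x
    obtain ⟨m, hm⟩ := lift_tor x
    simp only [F, hm, hSper]
  have hFm : StronglyMeasurable F := hSm.comp_measurable lift_measurable
  have hFb : ∀ᵐ t, ‖F t‖ ≤ ∫ k, b k ∂Measure.count := by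
    rw [← hmp.map_eq, ae_map_iff hmp.measurable.aemeasurable
      (measurableSet_le hFm.norm.measurable measurable_const)]
    filter_upwards [ae_restrict_mem measurableSet_cell] with x hx
    rw [hFT]; exact hSb x hx
  have hL2 : MemLp F 2 := MemLp.of_bound hFm.aestronglyMeasurable _ hFb
  have hcoef : ∀ m, UnitAddTorus.mFourierCoeff F m = 𝓕 G (lat m) := by
    intro m
    rw [UnitAddTorus.mFourierCoeff]
    conv_lhs => rw [← hmp.map_eq]
    rw [integral_map (f := fun t => UnitAddTorus.mFourier (-m) t • F t) hmp.measurable.aemeasurable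
      ((UnitAddTorus.mFourier (-m)).continuous.stronglyMeasurable.smul hFm).aestronglyMeasurable]
    simp only [hFT, mFourier_tor, smul_eq_mul]
    have hc : Continuous (fun x : EuclideanSpace ℝ (Fin n) =>
      ((Real.fourierChar (-inner ℝ x (lat m)) : Circle) : ℂ)) := by fun_prop
    have := integrable_unfold hG hGc hc.measurable (fun x k => by
      obtain ⟨z, hz⟩ := inner_lat_int m k
      simp only [inner_add_left, hz, Real.fourierChar_apply]
      rw [Complex.exp_eq_exp_iff_exists_int]
      exact ⟨-z, by push_cast; ring⟩)
      (Measure.integrableOn_of_bounded (M := 1) (by simp [volume_cell]) hc.aestronglyMeasurable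
        (.of_forall fun x => (Circle.norm_coe _).le))
    rw [Real.fourier_eq]
    refine (integral_congr_ae (.of_forall fun x => mul_comm _ _)).trans
      (this.2.symm.trans (integral_congr_ae (.of_forall fun x => mul_comm _ _)))
  have hae := hL2.coeFn_toLp
  have hcoef' : ∀ m, UnitAddTorus.mFourierCoeff (hL2.toLp F) m = 𝓕 G (lat m) := by
    intro m
    rw [← hcoef]
    refine integral_congr_ae ?_
    filter_upwards [hae] with t ht
    rw [ht]
  have hsum := UnitAddTorus.hasSum_mFourier_series_L2 (hL2.toLp F)
  have h0 := hasSum_single (f := fun i ↦ UnitAddTorus.mFourierCoeff (hL2.toLp F) i •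
    UnitAddTorus.mFourierLp 2 i) (0 : Fin n → ℤ) (fun m hm => by
      simp only [hcoef', hF m hm, zero_smul])
  have heq := hsum.unique h0
  have hc0 : 𝓕 G (lat (0 : Fin n → ℤ)) = ∫ x, G x := by
    have : lat (0 : Fin n → ℤ) = 0 := by ext i; simp
    rw [this, Real.fourier_eq]; simp
  have hfin : ∀ᵐ t, F t = ∫ x, G x := by
    have e1 := Lp.coeFn_smul (UnitAddTorus.mFourierCoeff (hL2.toLp F) 0)
      (UnitAddTorus.mFourierLp (d := Fin n) 2 0)
    rw [← heq] at e1
    filter_upwards [hae, e1, UnitAddTorus.coeFn_mFourierLp (d := Fin n) 2 0] with t h1 h2 h3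
    rw [← h1, h2, Pi.smul_apply, h3, hcoef', hc0, UnitAddTorus.mFourier_zero]
    simp
  have := hmp.quasiMeasurePreserving.ae hfin
  filter_upwards [this] with x hx
  rw [← hx, hFT]

lemma core {G : EuclideanSpace ℝ (Fin n) → ℂ} {C : ℝ} (hG : ∀ x, ‖G x‖ ≤ C * wt x)
    (hGc : Continuous G) (hF : ∀ m : Fin n → ℤ, m ≠ 0 → 𝓕 G (lat m) = 0)
    {a : EuclideanSpace ℝ (Fin n) → ℂ} (ham : Measurable a)
    (hap : ∀ x m, a (x + lat m) = a x) (hai : IntegrableOn a (cell n)) :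
    Integrable (fun x => G x * a x) ∧ ∫ x, G x * a x = (∫ x, G x) * ∫ x in cell n, a x := by
  obtain ⟨h1, h2⟩ := integrable_unfold hG hGc ham hap hai
  refine ⟨h1, h2.trans ?_⟩
  rw [← integral_const_mul]
  refine integral_congr_ae ?_
  filter_upwards [periodize_ae hG hGc hF] with x hx
  rw [hx]

lemma fourier_prod_eq_zero (f g : 𝓢(EuclideanSpace ℝ (Fin n), ℂ)) {d : ℝ}
    (hf : ∀ ξ, d < ‖ξ‖ → 𝓕 (⇑f) ξ = 0) (hg : ∀ ξ, d < ‖ξ‖ → 𝓕 (⇑g) ξ = 0)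
    (ξ : EuclideanSpace ℝ (Fin n)) (hξ : 2 * d < ‖ξ‖) :
    𝓕 (fun x => conj (f x) * g x) ξ = 0 := by
  let w : 𝓢(EuclideanSpace ℝ (Fin n), ℂ) := (𝓕 g).compSubConstCLM ℂ (-ξ)
  have hw : ∀ x, 𝓕⁻ w x = (Real.fourierChar (-inner ℝ x ξ) : ℂ) * g x := by
    intro x
    have h1 : g x = 𝓕⁻ (𝓕 g) x := by simp
    rw [h1, SchwartzMap.fourierInv_coe, SchwartzMap.fourierInv_coe, Real.fourierInv_eq, Real.fourierInv_eq,
      ← integral_const_mul, ← integral_add_right_eq_self _ (-ξ)]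
    congr 1
    ext v
    simp only [w, SchwartzMap.compSubConstCLM_apply, Circle.smul_def, smul_eq_mul, ← mul_assoc,
      ← Circle.coe_mul, ← AddChar.map_add_eq_mul]
    congr 3
    · rw [inner_add_left, inner_neg_left, real_inner_comm ξ x]; ring
    · abel
  have h := SchwartzMap.integral_sesq_fourier_eq f w (innerSL ℂ)
  simp only [innerSL_apply_apply, RCLike.inner_apply, hw] at h
  rw [Real.fourier_eq]
  trans ∫ x, (Real.fourierChar (-inner ℝ x ξ) : ℂ) * g x * conj (f x)
  · congr 1; ext x; simp only [Circle.smul_def, smul_eq_mul]; ring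
  rw [← h]
  refine integral_eq_zero_of_ae (.of_forall fun η => ?_)
  simp only [w, SchwartzMap.compSubConstCLM_apply, SchwartzMap.fourier_coe, Pi.zero_apply]
  by_cases h1 : d < ‖η‖
  · rw [hf η h1]; simp
  · rw [hg (η - -ξ), zero_mul]
    have : ‖ξ‖ ≤ ‖η - -ξ‖ + ‖η‖ := by
      calc ‖ξ‖ = ‖(η - -ξ) - η‖ := by congr 1; abel
        _ ≤ _ := norm_sub_le _ _
    linarith

lemma schwartz_decay (f : 𝓢(EuclideanSpace ℝ (Fin n), ℂ)) {ε : ℝ} (hε : 0 < ε) :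
    ∃ C : ℝ, ∀ x, ‖f (ε • x)‖ ≤ C * wt x := by
  refine ⟨(2 ^ (n+1) * (Finset.Iic (n+1, 0)).sup (fun m : ℕ × ℕ => SchwartzMap.seminorm ℝ m.1 m.2) f) /
    (min 1 ε) ^ (n+1), fun x => ?_⟩
  have h := SchwartzMap.one_add_le_sup_seminorm_apply (𝕜 := ℝ) (m := (n+1, 0)) (k := n + 1) (n := 0)
    le_rfl le_rfl f (ε • x)
  rw [norm_iteratedFDeriv_zero] at h
  have h2 : (min 1 ε * (1 + ‖x‖)) ^ (n+1) ≤ (1 + ‖ε • x‖) ^ (n+1) := by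
    have : 0 < min 1 ε := by positivity
    gcongr
    rw [norm_smul, Real.norm_eq_abs, abs_of_pos hε, mul_add, mul_one]
    gcongr
    · exact min_le_left _ _
    · exact min_le_right _ _
  have h3 : (min 1 ε * (1 + ‖x‖)) ^ (n+1) * ‖f (ε • x)‖ ≤ _ :=
    (mul_le_mul_of_nonneg_right h2 (norm_nonneg _)).trans h
  have hp : 0 < (min 1 ε) ^ (n+1) := by positivity
  rw [mul_pow] at h3
  rw [wt, ← div_eq_mul_inv, le_div_iff₀ (by positivity)]
  have h4 : (min 1 ε) ^ (n+1) * (‖f (ε • x)‖ * (1 + ‖x‖) ^ (n+1)) ≤ _ :=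
    le_trans (le_of_eq (by ring)) h3
  exact (le_div_iff₀' hp).2 h4

lemma one_le_norm_lat {m : Fin n → ℤ} (hm : m ≠ 0) : 1 ≤ ‖lat m‖ := by
  obtain ⟨i, hi⟩ := Function.ne_iff.1 hm
  have h := PiLp.norm_apply_le (lat m) i
  refine le_trans ?_ h
  rw [lat_apply, Real.norm_eq_abs]
  exact_mod_cast Int.one_le_abs hi

lemma pair (f g : 𝓢(EuclideanSpace ℝ (Fin n), ℂ)) {d : ℝ}
    (hf : ∀ ξ, d < ‖ξ‖ → 𝓕 (⇑f) ξ = 0) (hg : ∀ ξ, d < ‖ξ‖ → 𝓕 (⇑g) ξ = 0)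
    {ε : ℝ} (hε : 0 < ε) (hεd : 2 * ε * d < 1)
    {a : EuclideanSpace ℝ (Fin n) → ℂ} (ham : Measurable a)
    (hap : ∀ x m, a (x + lat m) = a x) (hai : IntegrableOn a (cell n)) :
    Integrable (fun x => conj (f (ε • x)) * g (ε • x) * a x) ∧
      ∫ x, conj (f (ε • x)) * g (ε • x) * a x
        = ((ε ^ n)⁻¹ : ℝ) * (∫ x, conj (f x) * g x) * ∫ x in cell n, a x := by
  obtain ⟨C, hC⟩ := schwartz_decay f hε
  obtain ⟨D, hD⟩ := g.decay 0 0
  have hD' : ∀ x, ‖g x‖ ≤ D := fun x => by simpa using hD.2 x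
  have hsc : ∀ H : EuclideanSpace ℝ (Fin n) → ℂ, ∫ x, H (ε • x) = ((ε ^ n)⁻¹ : ℝ) * ∫ x, H x := by
    intro H
    rw [Measure.integral_comp_smul, abs_of_pos (by positivity)]
    simp
  have := core (G := fun x => conj (f (ε • x)) * g (ε • x)) (C := C * D) (fun x => by
      rw [norm_mul, RCLike.norm_conj]
      calc _ ≤ (C * wt x) * D := mul_le_mul (hC x) (hD' _) (norm_nonneg _) ((norm_nonneg _).trans (hC x))
        _ = _ := by ring)
    (by
      have h1 := f.continuous
      have h2 := g.continuous
      have h3 := Complex.continuous_conj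
      fun_prop)
    (fun m hm => by
      have h0 := fourier_prod_eq_zero f g hf hg (ε⁻¹ • lat m) (by
        rw [norm_smul, norm_inv, Real.norm_eq_abs, abs_of_pos hε, ← div_eq_inv_mul, lt_div_iff₀ hε]
        have := one_le_norm_lat hm
        linarith)
      have h1 := hsc (fun x => Real.fourierChar (-inner ℝ x (ε⁻¹ • lat m)) • (conj (f x) * g x))
      rw [Real.fourier_eq] at h0 ⊢
      rw [h0, mul_zero] at h1
      rw [← h1]
      congr 1
      ext x
      rw [inner_smul_left, inner_smul_right]
      simp [hε.ne'])
    ham hap hai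
  rw [hsc (fun x => conj (f x) * g x)] at this
  exact this

end BLW

/-- **Norm identity for band-limited Bloch-type wavepackets** (Lemma 4.8 and the isometry step
in the proof of Lemma 6.2 of the paper): if `p_1, …, p_N` are `ℤⁿ`-periodic, orthonormal over
the unit cell, and `γ_1, …, γ_N` are Schwartz functions with Fourier transforms supported in
the closed ball of radius `d`, then for `0 < ε` with `2 ε d < 1`,
`∫ |∑_j γ_j(εx) p_j(x)|² dx = ε^{-n} ∑_j ∫ |γ_j|²`. -/
theorem bandlimited_wavepacket_norm
    {n N : ℕ} (hn : 1 ≤ n) (hN : 1 ≤ N)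
    (p : Fin N → EuclideanSpace ℝ (Fin n) → ℂ)
    (hp_meas : ∀ j, Measurable (p j))
    (hp_per : ∀ (j : Fin N) (x : EuclideanSpace ℝ (Fin n)) (m : Fin n → ℤ),
      p j (x + (WithLp.equiv 2 (Fin n → ℝ)).symm (fun i => (m i : ℝ))) = p j x)
    (hp_sq : ∀ j, IntegrableOn (fun x => ‖p j x‖ ^ 2)
      {x : EuclideanSpace ℝ (Fin n) | ∀ i, x i ∈ Set.Ico (0 : ℝ) 1})
    (hp_orth : ∀ j m : Fin N,
      ∫ x in {x : EuclideanSpace ℝ (Fin n) | ∀ i, x i ∈ Set.Ico (0 : ℝ) 1},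
        conj (p j x) * p m x = if j = m then 1 else 0)
    (γ : Fin N → 𝓢(EuclideanSpace ℝ (Fin n), ℂ)) (d : ℝ) (hd : 0 < d)
    (hγ_supp : ∀ (j : Fin N) (ξ : EuclideanSpace ℝ (Fin n)), d < ‖ξ‖ → 𝓕 (⇑(γ j)) ξ = 0)
    (ε : ℝ) (hε : 0 < ε) (hεd : 2 * ε * d < 1) :
    Integrable (fun x => ‖∑ j : Fin N, γ j (ε • x) * p j x‖ ^ 2) ∧
    ∫ x, ‖∑ j : Fin N, γ j (ε • x) * p j x‖ ^ 2 =
      (ε ^ n)⁻¹ * ∑ j : Fin N, ∫ X, ‖γ j X‖ ^ 2 := by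
  have key : ∀ j m : Fin N, _ := fun j m =>
    BLW.pair (γ j) (γ m) (hγ_supp j) (hγ_supp m) hε hεd (a := fun x => conj (p j x) * p m x)
      ((Complex.continuous_conj.measurable.comp (hp_meas j)).mul (hp_meas m))
      (fun x k => by
        have h1 := hp_per j x k
        have h2 := hp_per m x k
        simp only [BLW.lat, h1, h2])
      (by
        refine Integrable.mono ((hp_sq j).add (hp_sq m))
          ((Complex.continuous_conj.measurable.comp (hp_meas j)).mul (hp_meas m)).aestronglyMeasurable
          (.of_forall fun x => ?_)
        simp only [norm_mul, RCLike.norm_conj, Pi.add_apply]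
        rw [Real.norm_eq_abs, abs_of_nonneg (by positivity)]
        nlinarith [sq_nonneg (‖p j x‖ - ‖p m x‖), sq_nonneg (‖p j x‖), sq_nonneg (‖p m x‖)])
  have hexp : ∀ x, ((‖∑ j : Fin N, γ j (ε • x) * p j x‖ ^ 2 : ℝ) : ℂ) =
      ∑ j, ∑ m, conj (γ j (ε • x)) * γ m (ε • x) * (conj (p j x) * p m x) := by
    intro x
    rw [Complex.ofReal_pow, ← Complex.conj_mul', map_sum, Finset.sum_mul_sum]
    refine Finset.sum_congr rfl fun j _ => Finset.sum_congr rfl fun m _ => ?_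
    rw [map_mul]; ring
  have hint : Integrable (fun x => ((‖∑ j : Fin N, γ j (ε • x) * p j x‖ ^ 2 : ℝ) : ℂ)) := by
    simp only [hexp]
    exact integrable_finsetSum _ fun j _ => integrable_finsetSum _ fun m _ => (key j m).1
  refine ⟨by simpa only [RCLike.re_to_complex, Complex.ofReal_re] using hint.re, ?_⟩
  apply Complex.ofReal_injective
  rw [← integral_complex_ofReal]
  simp only [hexp]
  rw [integral_finsetSum _ fun j _ => integrable_finsetSum _ fun m _ => (key j m).1]
  rw [Complex.ofReal_mul, Complex.ofReal_sum, Finset.mul_sum]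
  refine Finset.sum_congr rfl fun j _ => ?_
  rw [integral_finsetSum _ fun m _ => (key j m).1]
  have hk : ∀ m, _ = _ := fun m => (key j m).2
  simp only [hk]
  have ho : ∀ m, ∫ x in BLW.cell n, conj (p j x) * p m x = if j = m then 1 else 0 := hp_orth j
  simp only [ho, mul_ite, mul_one, mul_zero, Finset.sum_ite_eq, Finset.mem_univ, if_true]
  rw [← integral_complex_ofReal]
  congr 2
  ext x
  rw [Complex.conj_mul', Complex.ofReal_pow]
end

section
/- Let n ≥ 1. Let p : ℝⁿ → ℂ be measurable and ℤⁿ-periodic, with p integrable on the unit cell [0,1)ⁿ. Let α : ℝⁿ → ℂ be a Schwartz function whose Fourier transform 𝓕α vanishes outside the closed ball of radius r > 0 centered at the origin. Then for every ξ ∈ ℝⁿ with ‖ξ‖ + r < 1, the function p·α is integrable on ℝⁿ and 𝓕(p·α)(ξ) = (∫_{[0,1)ⁿ} p(x) dx) · 𝓕α(ξ). -/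
open MeasureTheory FourierTransform
open scoped SchwartzMap

namespace LowFreq

/-- The integer lattice. -/
noncomputable abbrev lat (n : ℕ) : Submodule ℤ (EuclideanSpace ℝ (Fin n)) :=
  Submodule.span ℤ (Set.range (EuclideanSpace.basisFun (Fin n) ℝ).toBasis)

abbrev cell (n : ℕ) : Set (EuclideanSpace ℝ (Fin n)) := {x | ∀ i, x i ∈ Set.Ico (0 : ℝ) 1}

abbrev ivec {n : ℕ} (m : Fin n → ℤ) : EuclideanSpace ℝ (Fin n) :=
  (WithLp.equiv 2 (Fin n → ℝ)).symm (fun i => (m i : ℝ))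

lemma exists_ivec {n : ℕ} (l : lat n) : ∃ m : Fin n → ℤ, (l : EuclideanSpace ℝ (Fin n)) = ivec m := by
  have h := ((EuclideanSpace.basisFun (Fin n) ℝ).toBasis.mem_span_iff_repr_mem ℤ _).1 l.2
  choose m hm using h
  refine ⟨m, ?_⟩
  ext i
  simpa using (hm i).symm

lemma ivec_mem {n : ℕ} (m : Fin n → ℤ) : ivec m ∈ lat n := by
  rw [(EuclideanSpace.basisFun (Fin n) ℝ).toBasis.mem_span_iff_repr_mem ℤ]
  intro i
  exact ⟨m i, by simp⟩

lemma cell_eq (n : ℕ) :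
    ZSpan.fundamentalDomain (EuclideanSpace.basisFun (Fin n) ℝ).toBasis = cell n := by
  ext x
  simp [ZSpan.mem_fundamentalDomain]

lemma fund (n : ℕ) : IsAddFundamentalDomain (lat n) (cell n) volume := by
  rw [← cell_eq]
  exact ZSpan.isAddFundamentalDomain _ _

lemma cell_meas (n : ℕ) : MeasurableSet (cell n) := by
  rw [← cell_eq]
  exact ZSpan.fundamentalDomain_measurableSet _

lemma cell_bdd (n : ℕ) : ∃ R : ℝ, 0 ≤ R ∧ ∀ x ∈ cell n, ‖x‖ ≤ R := by
  have := ZSpan.fundamentalDomain_isBounded (EuclideanSpace.basisFun (Fin n) ℝ).toBasis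
  rw [cell_eq] at this
  obtain ⟨R, h0, h⟩ := this.exists_pos_norm_le
  exact ⟨R, h0.le, h⟩

lemma summ (n : ℕ) : Summable (fun l : lat n => ((1 + ‖l‖) ^ (n + 1))⁻¹) := by
  have h := ZLattice.summable_norm_pow_inv (lat n) (n + 1) (by
    rw [ZLattice.rank ℝ (lat n)]; simp)
  refine Summable.of_norm_bounded_eventually h ?_
  refine (Set.finite_singleton (0 : lat n)).subset ?_
  intro l hl
  by_contra h0
  apply hl
  have : 0 < ‖l‖ := norm_pos_iff.2 h0
  change ‖((1 + ‖l‖) ^ (n + 1))⁻¹‖ ≤ ‖l‖⁻¹ ^ (n + 1)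
  rw [Real.norm_of_nonneg (by positivity), inv_pow]
  gcongr
  linarith

lemma decay {n : ℕ} (α : 𝓢(EuclideanSpace ℝ (Fin n), ℂ)) (R : ℝ) (hR : 0 ≤ R) :
    ∃ u : lat n → ℝ, Summable u ∧ ∀ l : lat n, ∀ x : EuclideanSpace ℝ (Fin n), ‖x‖ ≤ R →
      ‖α (l +ᵥ x)‖ ≤ u l := by
  set C : ℝ := 2 ^ (n+1) * ((Finset.Iic (n + 1, 0)).sup fun m => SchwartzMap.seminorm ℝ m.1 m.2) α
  have hC : ∀ x, (1 + ‖x‖) ^ (n+1) * ‖α x‖ ≤ C := by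
    intro x
    simpa using SchwartzMap.one_add_le_sup_seminorm_apply (𝕜 := ℝ) (m := (n+1, 0)) (le_refl (n+1)) (le_refl 0) α x
  refine ⟨fun l => (C * (1 + R) ^ (n+1)) * ((1 + ‖l‖) ^ (n + 1))⁻¹, (summ n).mul_left _, ?_⟩
  intro l x hx
  have h1 := hC (l +ᵥ x)
  have h2 : 1 + ‖l‖ ≤ (1 + R) * (1 + ‖l +ᵥ x‖) := by
    have : ‖l‖ ≤ ‖l +ᵥ x‖ + ‖x‖ := by
      have := norm_sub_le (l +ᵥ x) x
      simpa [Submodule.vadd_def] using this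
    nlinarith [norm_nonneg (l +ᵥ x)]
  beta_reduce
  rw [← div_eq_mul_inv, le_div_iff₀ (by positivity)]
  calc ‖α (l +ᵥ x)‖ * (1 + ‖l‖) ^ (n+1) ≤ ‖α (l +ᵥ x)‖ * ((1 + R) * (1 + ‖l +ᵥ x‖)) ^ (n+1) := by gcongr
    _ = ((1 + ‖l +ᵥ x‖) ^ (n+1) * ‖α (l +ᵥ x)‖) * (1 + R) ^ (n+1) := by rw [mul_pow]; ring
    _ ≤ _ := by gcongr

lemma continuous_vadd_lat {n : ℕ} (l : lat n) :
    Continuous fun x : EuclideanSpace ℝ (Fin n) => l +ᵥ x := by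
  change Continuous fun x : EuclideanSpace ℝ (Fin n) => (l : EuclideanSpace ℝ (Fin n)) + x
  fun_prop

instance (n : ℕ) : VAddInvariantMeasure (lat n) (EuclideanSpace ℝ (Fin n)) volume :=
  ⟨fun c s _ => measure_preimage_add volume (c : EuclideanSpace ℝ (Fin n)) s⟩

/-- Unfolding. -/
lemma unfold_integral {n : ℕ} (q β : EuclideanSpace ℝ (Fin n) → ℂ) (hq : Measurable q)
    (hper : ∀ (l : lat n) x, q (l +ᵥ x) = q x) (hint : IntegrableOn q (cell n))
    (hβ : Continuous β) (u : lat n → ℝ) (hu : Summable u)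
    (hb : ∀ l : lat n, ∀ x ∈ cell n, ‖β (l +ᵥ x)‖ ≤ u l) :
    Integrable (fun x => q x * β x) ∧
    ∫ x, q x * β x = ∫ x in cell n, q x * ∑' l : lat n, β (l +ᵥ x) := by
  have hu0 : ∀ l, 0 ≤ u l := fun l => (norm_nonneg _).trans (hb l 0 (by simp [cell]))
  have hcont : ∀ l : lat n, Continuous fun x => β (l +ᵥ x) := fun l =>
    hβ.comp (continuous_vadd_lat l)
  have hI : ∀ l : lat n, IntegrableOn (fun x => q x * β (l +ᵥ x)) (cell n) := by
    intro l
    refine Integrable.mul_bdd (c := u l) hint (hcont l).aestronglyMeasurable ?_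
    exact (ae_restrict_iff' (cell_meas n)).2 (.of_forall (hb l))
  have hN : ∀ l : lat n, ∫ x in cell n, ‖q x * β (l +ᵥ x)‖ ≤ u l * ∫ x in cell n, ‖q x‖ := by
    intro l
    rw [← integral_const_mul]
    refine setIntegral_mono_on (hI l).norm (hint.norm.const_mul _) (cell_meas n) ?_
    intro x hx
    rw [norm_mul, mul_comm]
    gcongr
    exact hb l x hx
  have hS : Summable fun l : lat n => ∫ x in cell n, ‖q x * β (l +ᵥ x)‖ :=
    Summable.of_nonneg_of_le (fun l => integral_nonneg fun x => norm_nonneg _) hN (hu.mul_right _)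
  have hint : Integrable (fun x => q x * β x) := by
    refine ⟨(hq.mul hβ.measurable).aestronglyMeasurable, ?_⟩
    rw [HasFiniteIntegral, (fund n).lintegral_eq_tsum'']
    simp only [hper]
    have : ∀ l : lat n, ∫⁻ x in cell n, ‖q x * β (l +ᵥ x)‖ₑ
        = ENNReal.ofReal (∫ x in cell n, ‖q x * β (l +ᵥ x)‖) := fun l =>
      (ofReal_integral_norm_eq_lintegral_enorm (hI l)).symm
    simp only [this]
    exact hS.tsum_ofReal_lt_top
  refine ⟨hint, ?_⟩
  rw [(fund n).integral_eq_tsum'' _ hint]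
  simp only [hper, ← tsum_mul_left]
  exact integral_tsum_of_summable_integral_norm hI hS

lemma const_of_coeff {n : ℕ} (F : EuclideanSpace ℝ (Fin n) → ℂ) (hF : Continuous F)
    (hper : ∀ (l : lat n) x, F (l +ᵥ x) = F x)
    (h0 : ∀ k : Fin n → ℤ, k ≠ 0 →
      ∫ x in cell n, Complex.exp (-(2 * Real.pi * Complex.I * (∑ i, k i * x i : ℝ))) * F x = 0)
    (x : EuclideanSpace ℝ (Fin n)) : F x = ∫ y in cell n, F y := by
  let q : C(Fin n → ℝ, UnitAddTorus (Fin n)) := ⟨fun x i => (x i : UnitAddCircle), by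
    refine continuous_pi fun i => ?_
    exact (AddCircle.continuous_mk' 1).comp (continuous_apply i)⟩
  have hq : Topology.IsQuotientMap q := by
    have : IsOpenQuotientMap (Pi.map (fun (_ : Fin n) (x : ℝ) => (x : UnitAddCircle))) :=
      IsOpenQuotientMap.piMap fun i => QuotientAddGroup.isOpenQuotientMap_mk
    exact this.isQuotientMap
  let f : C(Fin n → ℝ, ℂ) := ⟨fun x => F (WithLp.toLp 2 x), by fun_prop⟩
  have hf : ∀ a b, q a = q b → f a = f b := by
    intro a b hab
    have : ∀ i, ∃ m : ℤ, b i + m = a i := by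
      intro i
      have h := congrFun hab i
      obtain ⟨m, hm⟩ := (QuotientAddGroup.eq_iff_sub_mem.1 h)
      refine ⟨m, ?_⟩
      simp at hm
      linarith
    choose m hm using this
    have := hper ⟨_, ivec_mem m⟩ (WithLp.toLp 2 b)
    simp only [f, ContinuousMap.coe_mk]
    rw [← this]
    congr 1
    ext i
    simp [Submodule.vadd_def, ← hm i, add_comm]
  let G : C(UnitAddTorus (Fin n), ℂ) := hq.lift f (fun a b h => hf a b h)
  have hG : ∀ x : Fin n → ℝ, G (fun i => (x i : UnitAddCircle)) = F (WithLp.toLp 2 x) := by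
    intro x
    exact DFunLike.congr_fun (hq.lift_comp f (fun a b h => hf a b h)) x
  have hcoef : ∀ k, UnitAddTorus.mFourierCoeff G k =
      ∫ x in cell n, Complex.exp (-(2 * Real.pi * Complex.I * (∑ i, k i * x i : ℝ))) * F x := by
    intro k
    rw [UnitAddTorus.mFourierCoeff_eq_integral _ _ 0]
    rw [← (PiLp.volume_preserving_toLp (Fin n)).setIntegral_preimage_emb
      (MeasurableEquiv.toLp 2 (Fin n → ℝ)).measurableEmbedding]
    have hs : (WithLp.toLp 2 ⁻¹' cell n : Set (Fin n → ℝ)) =ᵐ[volume]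
        {x : Fin n → ℝ | ∀ i, x i ∈ Set.Ioc ((0 : Fin n → ℝ) i) ((0 : Fin n → ℝ) i + 1)} := by
      have h1 : (WithLp.toLp 2 ⁻¹' cell n : Set (Fin n → ℝ)) = Set.univ.pi fun i => Set.Ico 0 1 := by
        ext x; simp [cell]
      have h2 : {x : Fin n → ℝ | ∀ i, x i ∈ Set.Ioc ((0 : Fin n → ℝ) i) ((0 : Fin n → ℝ) i + 1)}
        = Set.univ.pi fun i => Set.Ioc 0 1 := by
        ext x; simp
      rw [h1, h2]
      exact Measure.ae_eq_set_pi fun i _ => Ico_ae_eq_Ioc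
    rw [setIntegral_congr_set hs]
    congr 1
    ext x
    rw [hG, smul_eq_mul]
    congr 1
    simp only [UnitAddTorus.mFourier, ContinuousMap.coe_mk, fourier_coe_apply]
    rw [← Complex.exp_sum]
    congr 1
    push_cast
    rw [Finset.mul_sum, ← Finset.sum_neg_distrib]
    refine Finset.sum_congr rfl fun i _ => ?_
    simp
    ring
  have hz : ∀ k, k ≠ 0 → UnitAddTorus.mFourierCoeff G k = 0 := fun k hk => by
    rw [hcoef, h0 k hk]
  have hs : Summable (UnitAddTorus.mFourierCoeff G) :=
    summable_of_ne_finset_zero (s := {0}) (fun k hk => hz k (by simpa using hk))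
  have h := UnitAddTorus.hasSum_mFourier_series_apply_of_summable hs (fun i => (x i : UnitAddCircle))
  have h' := h.unique (hasSum_single 0 (fun k hk => by rw [hz k hk, zero_smul]))
  have hx := hG x.ofLp
  rw [h', hcoef] at hx
  simp only [UnitAddTorus.mFourier_zero] at hx
  simpa using hx.symm

lemma continuous_period {n : ℕ} (β : EuclideanSpace ℝ (Fin n) → ℂ) (hβ : Continuous β)
    (h : ∀ R : ℝ, 0 ≤ R → ∃ u : lat n → ℝ, Summable u ∧ ∀ l : lat n,
      ∀ x : EuclideanSpace ℝ (Fin n), ‖x‖ ≤ R → ‖β (l +ᵥ x)‖ ≤ u l) :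
    Continuous fun x => ∑' l : lat n, β (l +ᵥ x) := by
  rw [continuous_iff_continuousAt]
  intro x₀
  obtain ⟨u, hu, hb⟩ := h (‖x₀‖ + 1) (by positivity)
  have hc : ContinuousOn (fun x => ∑' l : lat n, β (l +ᵥ x)) (Metric.ball 0 (‖x₀‖ + 1)) :=
    continuousOn_tsum (fun l => (hβ.comp (continuous_vadd_lat l)).continuousOn) hu
      (fun l x hx => hb l x (by simpa using (mem_ball_zero_iff.1 hx).le))
  exact hc.continuousAt (Metric.isOpen_ball.mem_nhds (by simp))

lemma one_le_norm_ivec {n : ℕ} (k : Fin n → ℤ) (hk : k ≠ 0) : 1 ≤ ‖ivec k‖ := by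
  obtain ⟨i, hi⟩ := Function.ne_iff.1 hk
  have h1 : ‖(ivec k) i‖ ≤ ‖ivec k‖ := PiLp.norm_apply_le _ i
  have h2 : (1 : ℝ) ≤ |((k i : ℤ) : ℝ)| := by
    exact_mod_cast Int.one_le_abs hi
  exact h2.trans (by simpa using h1)

lemma char_periodic {n : ℕ} (k : Fin n → ℤ) (l : lat n) (x : EuclideanSpace ℝ (Fin n)) :
    Complex.exp (-(2 * Real.pi * Complex.I * (∑ i, k i * (l +ᵥ x) i : ℝ))) =
    Complex.exp (-(2 * Real.pi * Complex.I * (∑ i, k i * x i : ℝ))) := by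
  obtain ⟨m, hm⟩ := exists_ivec l
  have : ∀ i, (l +ᵥ x) i = m i + x i := by
    intro i
    simp [Submodule.vadd_def, hm]
  rw [Complex.exp_eq_exp_iff_exists_int]
  refine ⟨-∑ i, k i * m i, ?_⟩
  simp only [this, mul_add, Finset.sum_add_distrib]
  push_cast
  ring

end LowFreq

open LowFreq in
/-- **Low-frequency identity** (Section 6.1.2 of the paper): at frequencies `ξ` with
`‖ξ‖ + r < 1`, the Fourier transform of the product of a `ℤⁿ`-periodic function `p`
(integrable over the cell) with a band-limited Schwartz function `α` (Fourier support in the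
closed ball of radius `r`) sees only the mean of the periodic factor:
`𝓕(p α)(ξ) = (∫_{cell} p) 𝓕α(ξ)`. -/
theorem lowfreq_fourier_of_periodic_mul_bandlimited
    {n : ℕ} (hn : 1 ≤ n)
    (p : EuclideanSpace ℝ (Fin n) → ℂ) (hp_meas : Measurable p)
    (hp_per : ∀ (x : EuclideanSpace ℝ (Fin n)) (m : Fin n → ℤ),
      p (x + (WithLp.equiv 2 (Fin n → ℝ)).symm (fun i => (m i : ℝ))) = p x)
    (hp_int : IntegrableOn p {x : EuclideanSpace ℝ (Fin n) | ∀ i, x i ∈ Set.Ico (0 : ℝ) 1})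
    (α : 𝓢(EuclideanSpace ℝ (Fin n), ℂ)) (r : ℝ) (hr : 0 < r)
    (hα_supp : ∀ η : EuclideanSpace ℝ (Fin n), r < ‖η‖ → 𝓕 (⇑α) η = 0) :
    ∀ ξ : EuclideanSpace ℝ (Fin n), ‖ξ‖ + r < 1 →
      Integrable (fun x => p x * α x) ∧
      𝓕 (fun x => p x * α x) ξ =
        (∫ x in {x : EuclideanSpace ℝ (Fin n) | ∀ i, x i ∈ Set.Ico (0 : ℝ) 1}, p x) *
          𝓕 (⇑α) ξ := by
  intro ξ hξ
  set β : EuclideanSpace ℝ (Fin n) → ℂ :=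
    fun x => Complex.exp (↑(-2 * Real.pi * inner ℝ x ξ) * Complex.I) * α x with hβdef
  have hαc : Continuous α := α.continuous
  have hβ : Continuous β := by
    simp only [hβdef]
    fun_prop
  have hβn : ∀ x, ‖β x‖ = ‖α x‖ := by
    intro x
    simp only [hβdef, norm_mul, Complex.norm_exp_ofReal_mul_I, one_mul]
  have hdec : ∀ R : ℝ, 0 ≤ R → ∃ u : lat n → ℝ, Summable u ∧ ∀ l : lat n,
      ∀ x : EuclideanSpace ℝ (Fin n), ‖x‖ ≤ R → ‖β (l +ᵥ x)‖ ≤ u l := by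
    simpa only [hβn] using decay α
  obtain ⟨R, hR, hcell⟩ := cell_bdd n
  obtain ⟨u, hu, hub⟩ := hdec R hR
  have hub' : ∀ l : lat n, ∀ x ∈ cell n, ‖β (l +ᵥ x)‖ ≤ u l := fun l x hx => hub l x (hcell x hx)
  have hper : ∀ (l : lat n) x, p (l +ᵥ x) = p x := by
    intro l x
    obtain ⟨m, hm⟩ := exists_ivec l
    rw [← hp_per x m, Submodule.vadd_def, hm, vadd_eq_add, add_comm]
  have hfin : volume (cell n) ≠ ⊤ := by
    obtain ⟨R, hR, hcell⟩ := cell_bdd n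
    refine ((measure_mono (t := Metric.closedBall 0 R) ?_).trans_lt measure_closedBall_lt_top).ne
    intro x hx
    simpa using hcell x hx
  set F : EuclideanSpace ℝ (Fin n) → ℂ := fun x => ∑' l : lat n, β (l +ᵥ x) with hF
  have hFc : Continuous F := continuous_period β hβ hdec
  have hFper : ∀ (l : lat n) x, F (l +ᵥ x) = F x := by
    intro l x
    simp only [hF, vadd_vadd]
    exact (Equiv.addRight l).tsum_eq (fun l' => β (l' +ᵥ x))
  have hcoef : ∀ k : Fin n → ℤ,
      ∫ x in cell n, Complex.exp (-(2 * Real.pi * Complex.I * (∑ i, k i * x i : ℝ))) * F x =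
        𝓕 (⇑α) (ξ + ivec k) := by
    intro k
    have hcont : Continuous fun x : EuclideanSpace ℝ (Fin n) =>
        Complex.exp (-(2 * Real.pi * Complex.I * (∑ i, k i * x i : ℝ))) := by fun_prop
    rw [← (unfold_integral _ β hcont.measurable (char_periodic k) ?_ hβ u hu hub').2,
      Real.fourier_eq']
    · congr 1
      ext x
      rw [smul_eq_mul]
      simp only [hβdef]
      rw [← mul_assoc, ← Complex.exp_add, inner_add_right]
      congr 2
      have : inner ℝ x (ivec k) = ∑ i, (k i : ℝ) * x i := by
        simp [PiLp.inner_apply]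
      rw [this]
      push_cast
      ring
    · refine Measure.integrableOn_of_bounded (M := 1) hfin hcont.aestronglyMeasurable ?_
      refine .of_forall fun x => ?_
      rw [Complex.norm_exp]
      simp
  have hconst : ∀ x, F x = 𝓕 (⇑α) ξ := by
    intro x
    rw [const_of_coeff F hFc hFper ?_ x]
    · have := hcoef 0
      have h0 : (ivec 0 : EuclideanSpace ℝ (Fin n)) = 0 := by ext i; simp
      rw [h0, add_zero] at this
      simpa using this
    · intro k hk
      rw [hcoef k]
      apply hα_supp
      have h1 := one_le_norm_ivec k hk
      have h2 := norm_sub_le (ξ + ivec k) ξ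
      rw [add_sub_cancel_left] at h2
      linarith
  obtain ⟨hI, hE⟩ := unfold_integral p β hp_meas hper hp_int hβ u hu hub'
  obtain ⟨u', hu', hub2⟩ := decay α R hR
  refine ⟨(unfold_integral p α hp_meas hper hp_int hαc u' hu'
    (fun l x hx => hub2 l x (hcell x hx))).1, ?_⟩
  rw [Real.fourier_eq']
  calc _ = ∫ x, p x * β x := by
        congr 1
        ext x
        simp only [hβdef, smul_eq_mul]
        ring
    _ = ∫ x in cell n, p x * F x := hE
    _ = _ := by
        simp only [hconst]
        rw [integral_mul_const]
end

section
/- Let H be a complex Hilbert space, let M and W be unitary bounded linear operators on H, and let g₀ ∈ [0, π) be such that the spectrum of W is contained in the closed arc {e^{−iν} : ν ∈ ℝ, |ν| ≤ g₀}. Let v ∈ H and let δ, κ ≥ 0 satisfy ‖M v − W v‖ ≤ δ·‖v‖, ‖M v + v‖ ≤ κ·‖v‖, and δ + κ < 2·sin((π − g₀)/2). Then v = 0. -/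
/-- **Core of the proof of Theorem 4.9 (strict invariance on `BL_ε`)**: let `M` and `W` be
unitary operators on a complex Hilbert space, with the spectrum of `W` contained in the arc
`{e^{-iν} : |ν| ≤ g₀}`, `0 ≤ g₀ < π`. If `v` satisfies `‖Mv − Wv‖ ≤ δ‖v‖` and
`‖Mv + v‖ ≤ κ‖v‖` with `δ + κ < 2 sin((π − g₀)/2)`, then `v = 0`. -/
theorem component_near_minus_one_vanishes
    {H : Type*} [NormedAddCommGroup H] [InnerProductSpace ℂ H] [CompleteSpace H]
    (M W : H →L[ℂ] H) (hM : M ∈ unitary (H →L[ℂ] H)) (hW : W ∈ unitary (H →L[ℂ] H))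
    (g₀ : ℝ) (hg₀0 : 0 ≤ g₀) (hg₀π : g₀ < Real.pi)
    (hspec : spectrum ℂ W ⊆
      {z : ℂ | ∃ ν : ℝ, |ν| ≤ g₀ ∧ z = Complex.exp (-(ν : ℂ) * Complex.I)})
    (v : H) (δ κ : ℝ) (hδ : 0 ≤ δ) (hκ : 0 ≤ κ)
    (hMW : ‖M v - W v‖ ≤ δ * ‖v‖)
    (hMv : ‖M v + v‖ ≤ κ * ‖v‖)
    (hgap : δ + κ < 2 * Real.sin ((Real.pi - g₀) / 2)) :
    v = 0 := by
  have hc : 0 < 2 * Real.sin ((Real.pi - g₀) / 2) := by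
    have := Real.sin_pos_of_pos_of_lt_pi (x := (Real.pi - g₀) / 2) (by linarith)
      (by linarith [Real.pi_pos])
    linarith
  set c := 2 * Real.sin ((Real.pi - g₀) / 2) with hcdef
  have hcos : c = 2 * Real.cos (g₀ / 2) := by
    rw [hcdef, ← Real.cos_pi_div_two_sub]
    congr 2
    ring
  have hlow : ∀ z ∈ spectrum ℂ W, c ≤ ‖1 + z‖ := by
    intro z hz
    obtain ⟨ν, hν, rfl⟩ := hspec hz
    have h1 : Real.cos (g₀ / 2) ≤ Real.cos (ν / 2) := by
      rw [← Real.cos_abs (ν / 2)]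
      have h2 : |ν / 2| = |ν| / 2 := by rw [abs_div]; norm_num
      rw [h2]
      exact Real.cos_le_cos_of_nonneg_of_le_pi (by positivity) (by linarith) (by linarith)
    have h3 : (1 : ℂ) + Complex.exp (-(ν : ℂ) * Complex.I)
        = Complex.exp (((-ν / 2 : ℝ) : ℂ) * Complex.I) * ((2 * Real.cos (ν / 2) : ℝ) : ℂ) := by
      push_cast
      rw [Complex.two_cos, mul_add, ← Complex.exp_add, ← Complex.exp_add]
      rw [← Complex.exp_zero]
      congr 2 <;> ring
    rw [h3, norm_mul, Complex.norm_exp_ofReal_mul_I, one_mul, Complex.norm_real, hcos]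
    exact le_trans (by linarith) (le_abs_self _)
  have hne : ∀ z ∈ spectrum ℂ W, 1 + z ≠ 0 := fun z hz h => by
    have := hlow z hz
    rw [h, norm_zero] at this
    linarith
  haveI hn : IsStarNormal W := ⟨by
    rw [commute_iff_eq, (Unitary.mem_iff.mp hW).1, (Unitary.mem_iff.mp hW).2]⟩
  have hcont : ContinuousOn (fun z : ℂ => (1 + z)⁻¹) (spectrum ℂ W) :=
    ContinuousOn.inv₀ (by fun_prop) hne
  have hnorm : ‖cfc (fun z : ℂ => (1 + z)⁻¹) W‖ ≤ c⁻¹ := by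
    refine norm_cfc_le (by positivity) fun z hz => ?_
    rw [norm_inv]
    exact inv_anti₀ hc (hlow z hz)
  have hmul : cfc (fun z : ℂ => (1 + z)⁻¹) W * (1 + W) = 1 := by
    have h1 : cfc (fun z : ℂ => 1 + z) W = 1 + W := by
      rw [cfc_const_add (1 : ℂ) (fun z => z) W, cfc_id' ℂ W, map_one]
    rw [← h1, ← cfc_mul _ _ W hcont (by fun_prop), ← cfc_one ℂ W]
    exact cfc_congr fun z hz => inv_mul_cancel₀ (hne z hz)
  have hv : cfc (fun z : ℂ => (1 + z)⁻¹) W (v + W v) = v := by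
    simpa using congrArg (fun T : H →L[ℂ] H => T v) hmul
  have h5 : ‖v‖ ≤ c⁻¹ * ‖v + W v‖ := by
    conv_lhs => rw [← hv]
    exact ContinuousLinearMap.le_of_opNorm_le _ hnorm _
  have h6 : ‖v + W v‖ ≤ (δ + κ) * ‖v‖ := by
    have : v + W v = (M v + v) - (M v - W v) := by abel
    rw [this]
    linarith [norm_sub_le (M v + v) (M v - W v)]
  have h7 : c * ‖v‖ ≤ ‖v + W v‖ := by
    rwa [inv_mul_eq_div, le_div_iff₀' hc] at h5
  by_contra hv0
  have := norm_pos_iff.mpr hv0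
  nlinarith
end
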